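/- arXiv:1207.5874 — 2 statements merged into one kernel-verified Lean document; each statement's English description precedes it below -/
import Mathlib

section
/- Caffarelli–Kohn–Nirenberg inequality with power weights: for every a > 0 and every b with a−1 ≤ b < a, setting p = 2/(a−b), there exists a constant C = C(a,b) > 0 such that for every h ∈ C_c^∞(ℝ²), (∫_{ℝ²} |x|^{bp} |h(x)|^p dx)^{1/p} ≤ C (∫_{ℝ²} |x|^{2a} |∇h(x)|² dx)^{1/2}. -/
noncomputable section

open MeasureTheory Real Set ENNReal

/-- The plane `ℝ²`. -/
abbrev E2 := EuclideanSpace ℝ (Fin 2)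

/-- `L^p(ℝ²)` norm of a function on `ℝ²`. -/
def lpnorm {α : Type*} [NormedAddCommGroup α] (f : E2 → α) (p : ℝ≥0∞) : ℝ :=
  (eLpNorm f p volume).toReal

def ckw (ε : ℝ) (x : E2) : ℝ := ‖x‖ ^ 2 + ε

lemma ckw_pos {ε : ℝ} (hε : 0 < ε) (x : E2) : 0 < ckw ε x := by unfold ckw; positivity

lemma ckw_contDiff (ε : ℝ) : ContDiff ℝ 1 (ckw ε) := (contDiff_norm_sq ℝ).add contDiff_const

lemma ckw_rpow_contDiff {ε : ℝ} (hε : 0 < ε) (s : ℝ) : ContDiff ℝ 1 (fun x => ckw ε x ^ s) :=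
  (ckw_contDiff ε).rpow_const_of_ne fun x => (ckw_pos hε x).ne'

lemma ckw_hasFDerivAt {ε : ℝ} (hε : 0 < ε) (s : ℝ) (x : E2) :
    HasFDerivAt (fun x => ckw ε x ^ s) ((s * ckw ε x ^ (s - 1)) • (2 • innerSL ℝ x)) x := by
  have h1 : HasFDerivAt (ckw ε) (2 • innerSL ℝ x) x :=
    (hasStrictFDerivAt_norm_sq x).hasFDerivAt.add_const ε
  exact h1.rpow_const (Or.inl (ckw_pos hε x).ne')

lemma ckw_norm_le {ε : ℝ} (hε : 0 < ε) (x : E2) : ‖x‖ ≤ ckw ε x ^ (1 / 2 : ℝ) := by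
  rw [← Real.sqrt_eq_rpow]
  apply Real.le_sqrt_of_sq_le
  unfold ckw; linarith

/-- integrability of continuous times compactly supported -/
lemma ck_int {f g : E2 → ℝ} (hf : Continuous f) (hg : Continuous g) (hc : HasCompactSupport g) :
    Integrable (fun x => f x * g x) :=
  (hf.mul hg).integrable_of_hasCompactSupport hc.mul_left

lemma ck_cs {h : E2 → ℝ} (hc : HasCompactSupport h) (k : ℕ) (hk : k ≠ 0) :
    HasCompactSupport (fun x => h x ^ k) := by
  refine hc.mono fun x hx h0 => hx ?_
  simp only [h0]; simp [hk]

lemma ck_intJ {a ε : ℝ} (hε : 0 < ε) {h : E2 → ℝ} (hh : ContDiff ℝ 1 h)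
    (hc : HasCompactSupport h) (k : ℕ) (hk : k ≠ 0) :
    Integrable (fun x => ckw ε x ^ a * h x ^ k) :=
  ck_int (ckw_rpow_contDiff hε _).continuous (hh.continuous.pow k)
    (ck_cs hc k hk)

lemma ck_intQ {a ε : ℝ} (hε : 0 < ε) {h : E2 → ℝ} (hh : ContDiff ℝ 1 h)
    (hc : HasCompactSupport h) :
    Integrable (fun x => ckw ε x ^ a * ‖fderiv ℝ h x‖ ^ 2) :=
  ck_int (ckw_rpow_contDiff hε _).continuous ((hh.continuous_fderiv (by simp)).norm.pow 2)
    ((hc.fderiv ℝ).comp_left (g := fun t => ‖t‖ ^ 2) (by simp))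

lemma ck_div {G : E2 → ℝ} (hG : ContDiff ℝ 1 G) (hc : HasCompactSupport G) :
    ∫ x, (2 * G x + fderiv ℝ G x x) = 0 := by
  have key : ∀ i : Fin 2, ∫ x : E2, x i * fderiv ℝ G x (EuclideanSpace.single i 1) = - ∫ x, G x := by
    intro i
    have hf : ∀ x : E2, HasFDerivAt (fun x : E2 => x i) (EuclideanSpace.proj (𝕜 := ℝ) i) x :=
      fun x => (EuclideanSpace.proj (𝕜 := ℝ) i : E2 →L[ℝ] ℝ).hasFDerivAt
    have h1 : ∀ x : E2, fderiv ℝ (fun x : E2 => x i) x (EuclideanSpace.single i 1) = 1 := by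
      intro x; rw [(hf x).fderiv]; simp
    have hG' : Continuous fun x => fderiv ℝ G x (EuclideanSpace.single i 1) :=
      (hG.continuous_fderiv (by simp)).clm_apply continuous_const
    have := integral_mul_fderiv_eq_neg_fderiv_mul_of_integrable (μ := (volume : Measure E2))
      (f := fun x : E2 => x i) (g := G) (v := EuclideanSpace.single i 1) ?_ ?_ ?_
      (fun x _ => (hf x).differentiableAt) (fun x _ => hG.differentiable (by simp) x)
    · simpa only [h1, one_mul] using this
    · simp only [h1, one_mul]; exact hG.continuous.integrable_of_hasCompactSupport hc
    · exact ck_int (by fun_prop) hG' (hc.fderiv_apply ℝ _)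
    · exact ck_int (by fun_prop) hG.continuous hc
  have hint : ∀ i : Fin 2, Integrable fun x : E2 => x i * fderiv ℝ G x (EuclideanSpace.single i 1) := by
    intro i
    exact ck_int (by fun_prop) ((hG.continuous_fderiv (by simp)).clm_apply continuous_const)
      (hc.fderiv_apply ℝ _)
  have hx : ∀ x : E2, fderiv ℝ G x x = x 0 * fderiv ℝ G x (EuclideanSpace.single 0 1) +
      x 1 * fderiv ℝ G x (EuclideanSpace.single 1 1) := by
    intro x
    have : x = x 0 • EuclideanSpace.single 0 (1:ℝ) + x 1 • EuclideanSpace.single 1 (1:ℝ) := by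
      ext j; fin_cases j <;> simp
    have h2 := congrArg (fderiv ℝ G x) this
    rw [map_add, map_smul, map_smul] at h2
    simpa only [smul_eq_mul] using h2
  simp_rw [hx]
  rw [integral_add, integral_add (hint 0) (hint 1), key, key, integral_const_mul]
  · ring
  · exact (hG.continuous.integrable_of_hasCompactSupport hc).const_mul 2
  · exact (hint 0).add (hint 1)

lemma ck_hardy {a : ℝ} (ha : 0 < a) : ∃ C : ℝ, 0 < C ∧ ∀ ε : ℝ, 0 < ε → ∀ h : E2 → ℝ,
    ContDiff ℝ 1 h → HasCompactSupport h →
    ∫ x, ckw ε x ^ (a - 1) * h x ^ 2 ≤ C * ∫ x, ckw ε x ^ a * ‖fderiv ℝ h x‖ ^ 2 := by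
  obtain ⟨c, hc0, hc2, hca⟩ : ∃ c : ℝ, 0 < c ∧ c ≤ 2 ∧ c ≤ 2 * a :=
    ⟨min 2 (2 * a), by positivity, min_le_left _ _, min_le_right _ _⟩
  refine ⟨4 / c ^ 2, by positivity, fun ε hε h hh hc => ?_⟩
  have hG : ContDiff ℝ 1 fun x => ckw ε x ^ (a - 1) * h x ^ 2 :=
    (ckw_rpow_contDiff hε _).mul (hh.pow 2)
  have hGc : HasCompactSupport fun x => ckw ε x ^ (a - 1) * h x ^ 2 :=
    (ck_cs hc 2 (by simp)).mul_left
  have hdiv := ck_div hG hGc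
  have hJ := ck_intJ (a := a - 1) hε hh hc 2 (by simp)
  have hQ := ck_intQ (a := a) hε hh hc
  have hGx : ∀ x, fderiv ℝ (fun x => ckw ε x ^ (a - 1) * h x ^ 2) x x =
      2 * (a - 1) * ckw ε x ^ (a - 1 - 1) * ‖x‖ ^ 2 * h x ^ 2
        + ckw ε x ^ (a - 1) * (2 * h x * fderiv ℝ h x x) := by
    intro x
    have h2 : HasFDerivAt (fun x => h x ^ 2) _ x := (hh.differentiable (by simp) x).hasFDerivAt.pow 2
    rw [((ckw_hasFDerivAt hε (a - 1) x).fun_mul h2).fderiv]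
    simp
    ring
  have hle : 0 ≥ ∫ x, (c / 2 * (ckw ε x ^ (a - 1) * h x ^ 2) - 2 / c * (ckw ε x ^ a * ‖fderiv ℝ h x‖ ^ 2)) := by
    rw [← hdiv]
    apply integral_mono ((hJ.const_mul _).sub (hQ.const_mul _))
    · have hd : Continuous fun x => fderiv ℝ (fun x => ckw ε x ^ (a - 1) * h x ^ 2) x x :=
        (hG.continuous_fderiv (by simp)).clm_apply continuous_id
      refine (hJ.const_mul 2).add (hd.integrable_of_hasCompactSupport ?_)
      refine (hGc.fderiv ℝ).mono' ?_
      intro x hx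
      apply subset_tsupport
      intro h0
      apply hx
      simp only [h0]; simp
    · intro x
      simp only [hGx]
      have hw := ckw_pos hε x
      set w := ckw ε x with hwd
      set t := w ^ (1 / 2 : ℝ) with ht
      have htp : 0 < t := by positivity
      have e1 : w ^ a = w ^ (a - 1) * t ^ 2 := by
        rw [ht, ← Real.rpow_natCast, ← Real.rpow_mul hw.le, ← Real.rpow_add hw]; norm_num
      have e2 : w ^ (a - 1) = w ^ (a - 1 - 1) * w := by
        rw [← Real.rpow_add_one hw.ne']; ring_nf
      have hxw : ‖x‖ ^ 2 ≤ w := by rw [hwd, ckw]; linarith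
      have hxt : ‖x‖ ≤ t := ckw_norm_le hε x
      have hA : c * (w ^ (a - 1) * h x ^ 2) ≤
          2 * (w ^ (a - 1) * h x ^ 2) + 2 * (a - 1) * w ^ (a - 1 - 1) * ‖x‖ ^ 2 * h x ^ 2 := by
        have : c * w ≤ 2 * w + 2 * (a - 1) * ‖x‖ ^ 2 := by
          rcases le_total 1 a with h1 | h1
          · nlinarith [mul_nonneg (sub_nonneg.2 h1) (sq_nonneg ‖x‖)]
          · nlinarith [mul_le_mul_of_nonneg_left hxw (sub_nonneg.2 h1)]
        rw [e2]
        have := mul_le_mul_of_nonneg_left this (by positivity : 0 ≤ w ^ (a - 1 - 1) * h x ^ 2)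
        nlinarith
      have hB : - (c / 2 * h x ^ 2 + 2 / c * (t ^ 2 * ‖fderiv ℝ h x‖ ^ 2)) ≤ 2 * h x * fderiv ℝ h x x := by
        have h1 : |fderiv ℝ h x x| ≤ ‖fderiv ℝ h x‖ * t :=
          ((fderiv ℝ h x).le_opNorm x).trans (by gcongr)
        have h2 : |h x * fderiv ℝ h x x| ≤ |h x| * (‖fderiv ℝ h x‖ * t) := by
          rw [abs_mul]; gcongr
        have h3 : 2 * (|h x| * (‖fderiv ℝ h x‖ * t)) ≤ c / 2 * h x ^ 2 + 2 / c * (t ^ 2 * ‖fderiv ℝ h x‖ ^ 2) := by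
          rw [← sq_abs (h x)]
          have := sq_nonneg (c * |h x| - 2 * (‖fderiv ℝ h x‖ * t))
          have h4 : c / 2 * |h x| ^ 2 + 2 / c * (t ^ 2 * ‖fderiv ℝ h x‖ ^ 2) - 2 * (|h x| * (‖fderiv ℝ h x‖ * t))
             = (c * |h x| - 2 * (‖fderiv ℝ h x‖ * t)) ^ 2 / (2 * c) := by
            field_simp; ring
          have : 0 ≤ (c * |h x| - 2 * (‖fderiv ℝ h x‖ * t)) ^ 2 / (2 * c) := by positivity
          linarith
        have := neg_abs_le (h x * fderiv ℝ h x x)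
        linarith
      have hB' := mul_le_mul_of_nonneg_left hB (by positivity : 0 ≤ w ^ (a - 1))
      simp only [Pi.sub_apply, ← hwd]
      rw [e1]
      linarith
  rw [integral_sub (hJ.const_mul _) (hQ.const_mul _), integral_const_mul, integral_const_mul] at hle
  have h5 : c / 2 * ∫ x, ckw ε x ^ (a - 1) * h x ^ 2 ≤ 2 / c * ∫ x, ckw ε x ^ a * ‖fderiv ℝ h x‖ ^ 2 := by
    linarith
  calc _ = 2 / c * (c / 2 * ∫ x, ckw ε x ^ (a - 1) * h x ^ 2) := by field_simp
    _ ≤ 2 / c * (2 / c * ∫ x, ckw ε x ^ a * ‖fderiv ℝ h x‖ ^ 2) := by gcongr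
    _ = _ := by field_simp; ring

/-- Gagliardo-Nirenberg in real form -/
lemma ck_gn : ∃ C : ℝ, 0 < C ∧ ∀ u : E2 → ℝ, ContDiff ℝ 1 u → HasCompactSupport u →
    ∫ x, u x ^ 2 ≤ C * (∫ x, ‖fderiv ℝ u x‖) ^ 2 := by
  refine ⟨lintegralPowLePowLIntegralFDerivConst (volume : Measure E2) 2 + 1, by positivity,
    fun u hu hc => ?_⟩
  have h := lintegral_pow_le_pow_lintegral_fderiv (volume : Measure E2) hu hc (p := 2)
    (by simp; exact Real.HolderConjugate.two_two)
  have h1 : ∫⁻ x, ‖u x‖ₑ ^ (2:ℝ) = ENNReal.ofReal (∫ x, u x ^ 2) := by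
    rw [ofReal_integral_eq_lintegral_ofReal]
    · congr 1; ext x
      rw [← ofReal_norm, ENNReal.ofReal_rpow_of_nonneg (norm_nonneg _) (by norm_num)]
      simp
    · exact (hu.continuous.pow 2).integrable_of_hasCompactSupport
        (ck_cs hc 2 (by simp))
    · exact Filter.Eventually.of_forall fun x => sq_nonneg _
  have h2 : ∫⁻ x, ‖fderiv ℝ u x‖ₑ = ENNReal.ofReal (∫ x, ‖fderiv ℝ u x‖) := by
    rw [ofReal_integral_norm_eq_lintegral_enorm]
    exact (hu.continuous_fderiv (by simp)).integrable_of_hasCompactSupport (hc.fderiv ℝ)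
  have h0 : 0 ≤ ∫ x, ‖fderiv ℝ u x‖ := integral_nonneg fun x => norm_nonneg _
  rw [h1, h2, ENNReal.ofReal_rpow_of_nonneg h0 (by norm_num), ← ENNReal.ofReal_coe_nnreal,
    ← ENNReal.ofReal_mul (by positivity), ENNReal.ofReal_le_ofReal_iff (by positivity)] at h
  refine h.trans ?_
  rw [Real.rpow_two]
  gcongr
  linarith

lemma ck_pt {a ε : ℝ} (hε : 0 < ε) {h : E2 → ℝ} (hh : ContDiff ℝ 1 h) (k : ℕ) (x : E2) :
    ‖fderiv ℝ (fun x => ckw ε x ^ ((a * (k + 1) - 1) / 2) * h x ^ (k + 1)) x‖ ≤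
      1 / 2 * (ckw ε x ^ (a * k - 1) * h x ^ (2 * k))
      + ((a * (k + 1) - 1) ^ 2 * (ckw ε x ^ (a - 1) * h x ^ 2)
      + (k + 1) ^ 2 * (ckw ε x ^ a * ‖fderiv ℝ h x‖ ^ 2)) := by
  have h2 : HasFDerivAt (fun x => h x ^ (k + 1)) _ x :=
    (hh.differentiable (by simp) x).hasFDerivAt.pow (k + 1)
  rw [((ckw_hasFDerivAt hε ((a * (k + 1) - 1) / 2) x).fun_mul h2).fderiv]
  have hw := ckw_pos hε x
  have hxt := ckw_norm_le hε x
  set w := ckw ε x with hwd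
  set γ := (a * (k + 1) - 1) / 2 with hγ
  set A := w ^ ((a * k - 1) / 2) * |h x| ^ k with hA
  set B1 := w ^ ((a - 1) / 2) * |h x| with hB1
  set B2 := w ^ (a / 2) * ‖fderiv ℝ h x‖ with hB2
  have hA0 : 0 ≤ A := by positivity
  have eA : w ^ (a * k - 1) * h x ^ (2 * k) = A ^ 2 := by
    rw [hA, mul_pow, ← Real.rpow_natCast (w ^ _), ← Real.rpow_mul hw.le, ← pow_mul, mul_comm k 2,
      pow_mul |h x|, sq_abs, pow_mul]
    congr 2; push_cast; ring
  have eB1 : w ^ (a - 1) * h x ^ 2 = B1 ^ 2 := by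
    rw [hB1, mul_pow, ← Real.rpow_natCast (w ^ _), ← Real.rpow_mul hw.le, sq_abs]
    congr 2; push_cast; ring
  have eB2 : w ^ a * ‖fderiv ℝ h x‖ ^ 2 = B2 ^ 2 := by
    rw [hB2, mul_pow, ← Real.rpow_natCast (w ^ _), ← Real.rpow_mul hw.le]
    congr 2; push_cast; ring
  rw [eA, eB1, eB2]
  have f1 : w ^ γ * |h x| ^ k * ‖fderiv ℝ h x‖ = A * B2 := by
    have : w ^ γ = w ^ ((a * k - 1) / 2) * w ^ (a / 2) := by
      rw [← Real.rpow_add hw]; congr 1; rw [hγ]; ring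
    rw [this, hA, hB2]; ring
  have f2 : w ^ (γ - 1) * w ^ (1 / 2 : ℝ) * |h x| ^ (k + 1) = A * B1 := by
    have : w ^ (γ - 1) * w ^ (1 / 2 : ℝ) = w ^ ((a * k - 1) / 2) * w ^ ((a - 1) / 2) := by
      rw [← Real.rpow_add hw, ← Real.rpow_add hw]; congr 1; rw [hγ]; ring
    rw [this, hA, hB1]; ring
  have n1 : ‖w ^ γ • ((k + 1) • h x ^ (k + 1 - 1)) • fderiv ℝ h x‖ = (k + 1) * (A * B2) := by
    rw [← f1, norm_smul, norm_smul, nsmul_eq_mul, norm_mul, norm_pow, Real.norm_eq_abs, Real.norm_eq_abs,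
      Real.norm_eq_abs, abs_of_pos (by positivity : 0 < w ^ γ), abs_of_nonneg (by positivity)]
    push_cast
    ring
  have n2 : ‖h x ^ (k + 1) • (γ * w ^ (γ - 1)) • (2 • innerSL ℝ x)‖ ≤ 2 * |γ| * (A * B1) := by
    have : ‖(2 • innerSL ℝ x : E2 →L[ℝ] ℝ)‖ ≤ 2 * w ^ (1 / 2 : ℝ) := by
      rw [← Nat.cast_smul_eq_nsmul ℝ, norm_smul, innerSL_apply_norm]
      simpa using hxt
    rw [← f2, norm_smul, norm_smul, norm_mul, norm_pow, Real.norm_eq_abs, Real.norm_eq_abs,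
      Real.norm_eq_abs, abs_of_pos (by positivity : 0 < w ^ (γ - 1))]
    calc _ ≤ |h x| ^ (k + 1) * (|γ| * w ^ (γ - 1) * (2 * w ^ (1 / 2 : ℝ))) := by gcongr
      _ = _ := by ring
  refine (norm_add_le _ _).trans ?_
  rw [n1]
  have e3 : (a * (k + 1) - 1) ^ 2 = (2 * |γ|) ^ 2 := by rw [mul_pow, sq_abs, hγ]; ring
  rw [e3]
  nlinarith [sq_nonneg (A - ((k + 1) * B2 + 2 * |γ| * B1)), sq_nonneg ((k + 1) * B2 - 2 * |γ| * B1)]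

lemma ck_J {a : ℝ} (ha : 0 < a) (k : ℕ) : ∃ C : ℝ, 0 < C ∧ ∀ ε : ℝ, 0 < ε → ∀ h : E2 → ℝ,
    ContDiff ℝ 1 h → HasCompactSupport h → ∫ x, ckw ε x ^ a * ‖fderiv ℝ h x‖ ^ 2 ≤ 1 →
    ∫ x, ckw ε x ^ (a * (k + 1 : ℕ) - 1) * h x ^ (2 * (k + 1)) ≤ C := by
  obtain ⟨C1, hC1, H1⟩ := ck_hardy ha
  have H1' : ∀ ε : ℝ, 0 < ε → ∀ h : E2 → ℝ,
    ContDiff ℝ 1 h → HasCompactSupport h → ∫ x, ckw ε x ^ a * ‖fderiv ℝ h x‖ ^ 2 ≤ 1 →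
    ∫ x, ckw ε x ^ (a - 1) * h x ^ 2 ≤ C1 := by
    intro ε hε h hh hc hq
    exact (H1 ε hε h hh hc).trans (by nlinarith)
  obtain ⟨Cg, hCg, HG⟩ := ck_gn
  induction k with
  | zero =>
    refine ⟨C1, hC1, fun ε hε h hh hc hq => ?_⟩
    simpa using H1' ε hε h hh hc hq
  | succ k ih =>
    obtain ⟨C2, hC2, H2⟩ := ih
    set m := k + 1 with hm
    refine ⟨Cg * (1 / 2 * C2 + ((a * (m + 1) - 1) ^ 2 * C1 + (m + 1) ^ 2 * 1)) ^ 2,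
      by positivity, fun ε hε h hh hc hq => ?_⟩
    have i1 := ck_intJ (a := a * m - 1) hε hh hc (2 * m) (by simp [hm])
    have i2 := ck_intJ (a := a - 1) hε hh hc 2 (by simp)
    have i3 := ck_intQ (a := a) hε hh hc
    have hu : ContDiff ℝ 1 fun x => ckw ε x ^ ((a * (m + 1) - 1) / 2) * h x ^ (m + 1) :=
      (ckw_rpow_contDiff hε _).mul (hh.pow _)
    have hcu : HasCompactSupport fun x => ckw ε x ^ ((a * (m + 1) - 1) / 2) * h x ^ (m + 1) :=
      (ck_cs hc (m + 1) (by simp)).mul_left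
    have h3 := HG _ hu hcu
    have e : ∫ x, ckw ε x ^ (a * (m + 1 : ℕ) - 1) * h x ^ (2 * (m + 1)) =
        ∫ x, (ckw ε x ^ ((a * (m + 1) - 1) / 2) * h x ^ (m + 1)) ^ 2 := by
      congr 1; ext x
      rw [mul_pow, ← Real.rpow_natCast (ckw ε x ^ _), ← Real.rpow_mul (ckw_pos hε x).le, ← pow_mul,
        mul_comm (m + 1) 2]
      congr 2; push_cast; ring
    rw [e]
    refine h3.trans ?_
    have h0 : 0 ≤ ∫ x, ‖fderiv ℝ (fun x => ckw ε x ^ ((a * (m + 1) - 1) / 2) * h x ^ (m + 1)) x‖ :=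
      integral_nonneg fun x => norm_nonneg _
    gcongr
    calc _ ≤ ∫ x, (1 / 2 * (ckw ε x ^ (a * m - 1) * h x ^ (2 * m))
      + ((a * (m + 1) - 1) ^ 2 * (ckw ε x ^ (a - 1) * h x ^ 2)
      + (m + 1) ^ 2 * (ckw ε x ^ a * ‖fderiv ℝ h x‖ ^ 2))) := by
          apply integral_mono
          · exact ((hu.continuous_fderiv (by simp)).integrable_of_hasCompactSupport (hcu.fderiv ℝ)).norm
          · exact (i1.const_mul _).add ((i2.const_mul _).add (i3.const_mul _))
          · intro x; exact ck_pt hε hh m x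
      _ ≤ _ := by
          rw [integral_add (i1.const_mul _) (Integrable.fun_add (i2.const_mul _) (i3.const_mul _)),
            integral_add (i2.const_mul _) (i3.const_mul _), integral_const_mul, integral_const_mul,
            integral_const_mul]
          have := H2 ε hε h hh hc hq
          have := H1' ε hε h hh hc hq
          gcongr

lemma ck_I {a p : ℝ} (ha : 0 < a) (hp : 2 ≤ p) : ∃ C : ℝ, 0 < C ∧ ∀ ε : ℝ, 0 < ε → ∀ h : E2 → ℝ,
    ContDiff ℝ 1 h → HasCompactSupport h → ∫ x, ckw ε x ^ a * ‖fderiv ℝ h x‖ ^ 2 ≤ 1 →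
    ∫⁻ x, ENNReal.ofReal (ckw ε x ^ ((a * p - 2) / 2) * |h x| ^ p) ≤ ENNReal.ofReal C := by
  obtain ⟨k, hk⟩ := exists_nat_ge p
  obtain ⟨C1, hC1, H1⟩ := ck_J ha 0
  obtain ⟨C2, hC2, H2⟩ := ck_J ha k
  refine ⟨C1 + C2, by positivity, fun ε hε h hh hc hq => ?_⟩
  have i1 := ck_intJ (a := a * (0 + 1 : ℕ) - 1) hε hh hc (2 * (0 + 1)) (by simp)
  have i2 := ck_intJ (a := a * (k + 1 : ℕ) - 1) hε hh hc (2 * (k + 1)) (by simp)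
  calc _ ≤ ∫⁻ x, ENNReal.ofReal (ckw ε x ^ (a * (0 + 1 : ℕ) - 1) * h x ^ (2 * (0 + 1)) +
        ckw ε x ^ (a * (k + 1 : ℕ) - 1) * h x ^ (2 * (k + 1))) := by
        apply lintegral_mono
        intro x
        apply ENNReal.ofReal_le_ofReal
        have hw := ckw_pos hε x
        set w := ckw ε x
        set y := w ^ (a / 2) * |h x| with hy
        have hy0 : 0 ≤ y := by positivity
        have e1 : w ^ ((a * p - 2) / 2) * |h x| ^ p = w ^ (-1 : ℝ) * y ^ p := by
          rw [hy, Real.mul_rpow (by positivity) (by positivity), ← Real.rpow_mul hw.le, ← mul_assoc,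
            ← Real.rpow_add hw]
          congr 2; ring
        have e2 : ∀ n : ℕ, w ^ (a * n - 1) * h x ^ (2 * n) = w ^ (-1 : ℝ) * y ^ (2 * n) := by
          intro n
          rw [hy, mul_pow, ← Real.rpow_natCast (w ^ _), ← Real.rpow_mul hw.le, ← mul_assoc,
            ← Real.rpow_add hw, pow_mul |h x|, sq_abs, pow_mul]
          congr 2; push_cast; ring
        rw [e1, e2, e2, ← mul_add]
        gcongr
        rcases le_total y 1 with h1 | h1
        · have : y ^ p ≤ y ^ (2 * (0 + 1)) := by
            rw [← Real.rpow_natCast]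
            exact Real.rpow_le_rpow_of_exponent_ge_of_imp hy0 h1 (by push_cast; linarith) (by intro _ h; linarith)
          have : 0 ≤ y ^ (2 * (k + 1)) := by positivity
          linarith
        · have : y ^ p ≤ y ^ (2 * (k + 1)) := by
            rw [← Real.rpow_natCast]
            exact Real.rpow_le_rpow_of_exponent_le h1 (by push_cast; linarith)
          have : 0 ≤ y ^ (2 * (0 + 1)) := by positivity
          linarith
    _ = ENNReal.ofReal (∫ x, (ckw ε x ^ (a * (0 + 1 : ℕ) - 1) * h x ^ (2 * (0 + 1)) +
        ckw ε x ^ (a * (k + 1 : ℕ) - 1) * h x ^ (2 * (k + 1)))) := by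
        rw [ofReal_integral_eq_lintegral_ofReal (Integrable.fun_add i1 i2)]
        refine Filter.Eventually.of_forall fun x => ?_
        have hw := ckw_pos hε x
        have h1 := (even_two_mul (k + 1)).pow_nonneg (h x)
        have h2 := (even_two_mul (0 + 1)).pow_nonneg (h x)
        exact add_nonneg (mul_nonneg (Real.rpow_nonneg hw.le _) h2)
          (mul_nonneg (Real.rpow_nonneg hw.le _) h1)
    _ ≤ _ := by
        apply ENNReal.ofReal_le_ofReal
        rw [integral_add i1 i2]
        exact add_le_add (H1 ε hε h hh hc hq) (H2 ε hε h hh hc hq)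

lemma ck_lim {a p : ℝ} (ha : 0 < a) (hp : 2 ≤ p) : ∃ C : ℝ, 0 < C ∧ ∀ h : E2 → ℝ,
    ContDiff ℝ 1 h → HasCompactSupport h → ∫ x : E2, ‖x‖ ^ (2 * a) * ‖fderiv ℝ h x‖ ^ 2 < 1 →
    ∫ x : E2, ‖x‖ ^ (a * p - 2) * |h x| ^ p ≤ C := by
  obtain ⟨C, hC, H⟩ := ck_I ha hp
  refine ⟨C, hC, fun h hh hc hq => ?_⟩
  have hε : ∀ n : ℕ, 0 < 1 / ((n : ℝ) + 1) := fun n => by positivity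
  have hε0 := tendsto_one_div_add_atTop_nhds_zero_nat (𝕜 := ℝ)
  have hwl : ∀ x : E2, Filter.Tendsto (fun n : ℕ => ckw (1 / ((n : ℝ) + 1)) x) Filter.atTop (nhds (‖x‖ ^ 2)) := by
    intro x
    simpa [ckw] using (tendsto_const_nhds (x := ‖x‖ ^ 2)).add hε0
  have hsq : ∀ (x : E2) (s : ℝ), (‖x‖ ^ 2) ^ (s / 2) = ‖x‖ ^ s := by
    intro x s
    rw [← Real.rpow_natCast, ← Real.rpow_mul (norm_nonneg _)]; congr 1; push_cast; ring
  have hQ : Filter.Tendsto (fun n : ℕ => ∫ x, ckw (1 / ((n : ℝ) + 1)) x ^ a * ‖fderiv ℝ h x‖ ^ 2)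
      Filter.atTop (nhds (∫ x : E2, ‖x‖ ^ (2 * a) * ‖fderiv ℝ h x‖ ^ 2)) := by
    apply tendsto_integral_of_dominated_convergence (fun x => ckw 1 x ^ a * ‖fderiv ℝ h x‖ ^ 2)
    · intro n
      exact (ck_intQ (hε n) hh hc).aestronglyMeasurable
    · exact ck_intQ one_pos hh hc
    · intro n
      refine Filter.Eventually.of_forall fun x => ?_
      have hw := ckw_pos (hε n) x
      rw [Real.norm_of_nonneg (by positivity)]
      gcongr
      unfold ckw
      gcongr
      rw [div_le_one (by positivity)]
      have : (0:ℝ) ≤ n := by positivity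
      linarith
    · refine Filter.Eventually.of_forall fun x => ?_
      have := ((hwl x).rpow_const (p := a) (Or.inr ha.le)).mul_const (‖fderiv ℝ h x‖ ^ 2)
      have e := hsq x (2 * a)
      rw [mul_div_cancel_left₀ _ two_ne_zero] at e
      rwa [e] at this
  have hev := (hQ.eventually (gt_mem_nhds hq)).mono fun n hn =>
    H _ (hε n) h hh hc (le_of_lt hn)
  have hmeas : ∀ n : ℕ, Measurable fun x => ENNReal.ofReal
      (ckw (1 / ((n : ℝ) + 1)) x ^ ((a * p - 2) / 2) * |h x| ^ p) := by
    intro n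
    have := (ckw_rpow_contDiff (hε n) ((a * p - 2) / 2)).continuous.measurable
    have := hh.continuous.measurable
    fun_prop
  have hF : ∫⁻ x : E2, ENNReal.ofReal (‖x‖ ^ (a * p - 2) * |h x| ^ p) ≤ ENNReal.ofReal C := by
    calc _ = ∫⁻ x : E2, Filter.liminf (fun n : ℕ => ENNReal.ofReal
        (ckw (1 / ((n : ℝ) + 1)) x ^ ((a * p - 2) / 2) * |h x| ^ p)) Filter.atTop := by
          apply lintegral_congr_ae
          have h0 : ∀ᵐ x : E2, x ≠ 0 := by
            simp [ae_iff]
          filter_upwards [h0] with x hx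
          have hx2 : ‖x‖ ^ 2 ≠ 0 := by simpa using hx
          have := ((hwl x).rpow_const (p := (a * p - 2) / 2) (Or.inl hx2)).mul_const (|h x| ^ p)
          rw [hsq] at this
          exact ((ENNReal.continuous_ofReal.tendsto _).comp this).liminf_eq.symm
      _ ≤ _ := lintegral_liminf_le hmeas
      _ ≤ _ := by
          exact Filter.liminf_le_of_frequently_le' hev.frequently
  rw [integral_eq_lintegral_of_nonneg_ae]
  · exact ENNReal.toReal_le_of_le_ofReal hC.le hF
  · exact Filter.Eventually.of_forall fun x => by simp only [Pi.zero_apply]; positivity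
  · have := hh.continuous.measurable
    apply Measurable.aestronglyMeasurable
    fun_prop

/-- **Caffarelli–Kohn–Nirenberg inequality with power weights** (Lemma 2.3(2)): for
`a > 0`, `a−1 ≤ b < a` and `p = 2/(a−b)`, there is `C = C(a,b) > 0` such that for every
`h ∈ C_c^∞(ℝ²)`,
`(∫ |x|^{bp} |h|^p)^{1/p} ≤ C (∫ |x|^{2a} |∇h|²)^{1/2}`. -/
theorem caffarelli_kohn_nirenberg_weighted (a b : ℝ) (ha : 0 < a) (hab₁ : a - 1 ≤ b)
    (hab₂ : b < a) :
    ∃ C : ℝ, 0 < C ∧ ∀ h : E2 → ℝ, ContDiff ℝ (⊤ : ℕ∞) h → HasCompactSupport h →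
      (∫ x : E2, ‖x‖ ^ (b * (2 / (a - b))) * |h x| ^ (2 / (a - b))) ^ ((a - b) / 2) ≤
        C * (∫ x : E2, ‖x‖ ^ (2 * a) * ‖fderiv ℝ h x‖ ^ 2) ^ ((1:ℝ) / 2) := by
  have hd : 0 < a - b := by linarith
  obtain ⟨p, hp⟩ : ∃ p, p = 2 / (a - b) := ⟨_, rfl⟩
  have hp2 : 2 ≤ p := by rw [hp, le_div_iff₀ hd]; linarith
  have hp0 : 0 < p := by linarith
  have e1 : b * p = a * p - 2 := by rw [hp]; field_simp; ring
  have e2 : (a - b) / 2 = 1 / p := by rw [hp]; field_simp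
  rw [← hp, e1, e2]
  obtain ⟨C, hC, H⟩ := ck_lim ha hp2
  refine ⟨C ^ (1 / p), by positivity, fun h hh hc => ?_⟩
  have hh1 : ContDiff ℝ 1 h := hh.of_le (by exact_mod_cast le_top)
  set Q := ∫ x : E2, ‖x‖ ^ (2 * a) * ‖fderiv ℝ h x‖ ^ 2 with hQ
  set I := ∫ x : E2, ‖x‖ ^ (a * p - 2) * |h x| ^ p with hI
  have hQ0 : 0 ≤ Q := integral_nonneg fun x => by simp only [Pi.zero_apply]; positivity
  have hI0 : 0 ≤ I := integral_nonneg fun x => by simp only [Pi.zero_apply]; positivity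
  rw [← Real.sqrt_eq_rpow]
  have key : ∀ T : ℝ, √Q < T → I ^ (1 / p) ≤ C ^ (1 / p) * T := by
    intro T hT
    have hT0 : 0 < T := (Real.sqrt_nonneg _).trans_lt hT
    have hQT : Q < T ^ 2 := (Real.sqrt_lt' hT0).1 hT
    have h1 := H (fun x => T⁻¹ * h x) (contDiff_const.mul hh1) hc.mul_left ?_
    · have : ∫ x : E2, ‖x‖ ^ (a * p - 2) * |T⁻¹ * h x| ^ p = T⁻¹ ^ p * I := by
        rw [hI, ← integral_const_mul]
        congr 1; ext x
        rw [abs_mul, Real.mul_rpow (abs_nonneg _) (abs_nonneg _), abs_of_pos (by positivity)]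
        ring
      rw [this, Real.inv_rpow hT0.le, inv_mul_le_iff₀ (by positivity)] at h1
      calc I ^ (1 / p) ≤ (T ^ p * C) ^ (1 / p) := by gcongr
        _ = _ := by
          rw [Real.mul_rpow (by positivity) hC.le, ← Real.rpow_mul hT0.le, mul_one_div_cancel hp0.ne',
            Real.rpow_one, mul_comm]
    · have : ∫ x : E2, ‖x‖ ^ (2 * a) * ‖fderiv ℝ (fun x => T⁻¹ * h x) x‖ ^ 2 = (T ^ 2)⁻¹ * Q := by
        rw [hQ, ← integral_const_mul]
        congr 1; ext x
        rw [fderiv_const_mul (hh1.differentiable (by simp) x), norm_smul, mul_pow, Real.norm_eq_abs, sq_abs,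
          inv_pow]
        ring
      rw [this, inv_mul_lt_iff₀ (by positivity)]
      linarith
  have hC' : 0 < C ^ (1 / p) := by positivity
  rw [← div_le_iff₀' hC']
  apply le_of_forall_gt_imp_ge_of_dense
  intro T hT
  rw [div_le_iff₀' hC']
  exact key T hT
end
end

section
/- L^p bound of the full gradient by divergence and vorticity in ℝ²: for every 1 < p < ∞ there exists a constant C = C(p) > 0 such that for all vector fields u = (u₁,u₂) ∈ C_c^∞(ℝ²;ℝ²), ‖∇u‖_{L^p(ℝ²)} ≤ C (‖div u‖_{L^p(ℝ²)} + ‖ω‖_{L^p(ℝ²)}), where div u = ∂_{x₁}u₁ + ∂_{x₂}u₂ and ω = ∂_{x₁}u₂ − ∂_{x₂}u₁. -/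
noncomputable section

open MeasureTheory Real Set ENNReal

/-- `i`-th partial derivative of a scalar field on `ℝ²`. -/
def pd (f : E2 → ℝ) (i : Fin 2) (x : E2) : ℝ := fderiv ℝ f x (EuclideanSpace.single i 1)

/-- Divergence of a vector field on `ℝ²`. -/
def div2 (u : E2 → E2) (x : E2) : ℝ := ∑ i : Fin 2, pd (fun y => u y i) i x

/-- Vorticity `ω = ∂₁u₂ − ∂₂u₁` of a vector field on `ℝ²`. -/
def vort (u : E2 → E2) (x : E2) : ℝ := pd (fun y => u y 1) 0 x - pd (fun y => u y 0) 1 x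


/-- second derivative test along a segment -/
lemma midpoint_of_deriv2 (φ φ' φ'' : ℝ → ℝ) (c : ℝ)
    (h1 : ∀ s ∈ Icc (0:ℝ) 1, HasDerivAt φ (φ' s) s)
    (h2 : ∀ s ∈ Icc (0:ℝ) 1, HasDerivAt φ' (φ'' s) s)
    (h3 : ∀ s ∈ Icc (0:ℝ) 1, 2 * c ≤ φ'' s) :
    φ (1/2) + c / 4 ≤ (φ 0 + φ 1) / 2 := by
  have hconv : ConvexOn ℝ (Icc (0:ℝ) 1) (fun s => φ s - c * s ^ 2) := by
    apply convexOn_of_hasDerivWithinAt2_nonneg (convex_Icc 0 1)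
      (f' := fun s => φ' s - c * (2 * s)) (f'' := fun s => φ'' s - c * 2)
    · intro s hs
      exact ((h1 s hs).continuousAt.sub (by fun_prop)).continuousWithinAt
    · intro s hs
      rw [interior_Icc] at hs
      have := ((h1 s (Ioo_subset_Icc_self hs)).sub (((hasDerivAt_id s).pow 2).const_mul c))
      refine (this.congr_deriv ?_).hasDerivWithinAt
      simp
    · intro s hs
      rw [interior_Icc] at hs
      have := ((h2 s (Ioo_subset_Icc_self hs)).sub ((((hasDerivAt_id s).const_mul 2)).const_mul c))
      refine (this.congr_deriv ?_).hasDerivWithinAt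
      simp
    · intro s hs
      rw [interior_Icc] at hs
      have := h3 s (Ioo_subset_Icc_self hs)
      linarith
  have := hconv.2 (left_mem_Icc.2 zero_le_one) (right_mem_Icc.2 zero_le_one)
    (show (0:ℝ) ≤ 1/2 by norm_num) (show (0:ℝ) ≤ 1/2 by norm_num) (by norm_num)
  simp only [smul_eq_mul] at this
  norm_num at this
  linarith

/-- the Bellman function -/
def bell (p q A : ℝ) (x y : ℝ) : ℝ := x ^ 2 * (|x| ^ p + |y| ^ q) ^ (1 - 2 / p) + A * |y| ^ q

lemma bell_continuous (p q A : ℝ) (hp : 2 ≤ p) (hq : 0 < q) :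
    Continuous (fun z : ℝ × ℝ => bell p q A z.1 z.2) := by
  unfold bell
  have h0 : 0 ≤ 1 - 2 / p := by
    have : 2 / p ≤ 1 := by rw [div_le_one] <;> linarith
    linarith
  have h1 : Continuous (fun z : ℝ × ℝ => |z.1| ^ p) :=
    Continuous.rpow_const (by fun_prop) (fun _ => Or.inr (by linarith))
  have h2 : Continuous (fun z : ℝ × ℝ => |z.2| ^ q) :=
    Continuous.rpow_const (by fun_prop) (fun _ => Or.inr hq.le)
  have h3 : Continuous (fun z : ℝ × ℝ => (|z.1| ^ p + |z.2| ^ q) ^ (1 - 2 / p)) :=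
    Continuous.rpow_const (by fun_prop) (fun _ => Or.inr h0)
  fun_prop

/-- algebraic core of the Hessian bound -/
lemma bell_alg (p q th al be a b : ℝ) (hp : 2 ≤ p) (hq1 : 1 < q) (hq2 : q ≤ 2)
    (hth : th = 1 - 2 / p) (hal : 0 ≤ al) (hbe : 0 ≤ be) (hab : al + be = 1) :
    a ^ 2 - 24 * be * b ^ 2 ≤ 2 * a ^ 2 + 4 * th * a * (p * al * a + q * be * b)
      + th * (th - 1) * (p * al * a + q * be * b) ^ 2
      + th * (p * (p - 1) * al * a ^ 2 + q * (q - 1) * be * b ^ 2) := by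
  have hp0 : 0 < p := by linarith
  have h0 : 0 ≤ th := by
    have : 2 / p ≤ 1 := by rw [div_le_one] <;> linarith
    linarith
  have h1 : th ≤ 1 := by
    have : 0 ≤ 2 / p := by positivity
    linarith
  have e1 : th * (th - 1) * (p * al * a + q * be * b) ^ 2
      = - (2 * th * p * al ^ 2 * a ^ 2 + 4 * th * q * al * be * (a * b)
        + 2 * th * q ^ 2 / p * be ^ 2 * b ^ 2) := by
    have : th - 1 = - (2 / p) := by linarith
    rw [this]; field_simp; ring
  rw [e1]
  have hal1 : al ≤ 1 := by linarith
  have hbe1 : be ≤ 1 := by linarith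
  have i1 : 0 ≤ th * p * al * a ^ 2 * (4 - 2 * al + (p - 1)) := by
    have : 0 ≤ 4 - 2 * al + (p - 1) := by linarith
    positivity
  have i2 : 0 ≤ th * q * (q - 1) * be * b ^ 2 := by
    have : 0 ≤ q - 1 := by linarith
    positivity
  have i3 : 2 * th * q ^ 2 / p * be ^ 2 * b ^ 2 ≤ 8 * be * b ^ 2 := by
    have : 2 * th * q ^ 2 / p ≤ 8 := by
      rw [div_le_iff₀ hp0]
      have : q ^ 2 ≤ 4 := by nlinarith
      have : th * q ^ 2 ≤ 1 * 4 := mul_le_mul h1 this (by positivity) (by norm_num)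
      linarith
    have h2 : be ^ 2 ≤ be := by nlinarith
    have : 2 * th * q ^ 2 / p * be ^ 2 ≤ 8 * be := mul_le_mul this h2 (by positivity) (by norm_num)
    exact mul_le_mul_of_nonneg_right this (by positivity)
  have i4 : - (a ^ 2 + 16 * be * b ^ 2) ≤ 4 * th * q * be * (1 - al) * (a * b) := by
    have e : 1 - al = be := by linarith
    rw [e]
    have s1 : 0 ≤ (a + 2 * th * q * be ^ 2 * b) ^ 2 := sq_nonneg _
    have s2 : (2 * th * q * be ^ 2 * b) ^ 2 ≤ 16 * be * b ^ 2 := by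
      have t1 : th * q ≤ 2 := by nlinarith
      have t0 : 0 ≤ th * q := by positivity
      have t2 : (th * q) ^ 2 ≤ 4 := by nlinarith
      have t3 : be ^ 4 ≤ be := by
        have := pow_le_pow_of_le_one hbe hbe1 (show 1 ≤ 4 by norm_num)
        simpa using this
      have : (th * q) ^ 2 * be ^ 4 ≤ 4 * be := mul_le_mul t2 t3 (by positivity) (by norm_num)
      nlinarith [sq_nonneg b]
    nlinarith
  nlinarith

set_option maxHeartbeats 800000 in
/-- Hessian bound -/
lemma bell_hess (p q A x y a b : ℝ) (hp : 2 ≤ p) (hq1 : 1 < q) (hq2 : q ≤ 2)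
    (hpq : 1 / p + 1 / q = 1) (hA : A * (q * (q - 1)) = 25) (hx : 0 < x) (hy : 0 < y) :
    2 * |a * b| ≤
      2 * a ^ 2 * (x ^ p + y ^ q) ^ (1 - 2 / p)
      + 4 * a * (1 - 2 / p) * x * (x ^ p + y ^ q) ^ (1 - 2 / p - 1) *
          (p * x ^ (p - 1) * a + q * y ^ (q - 1) * b)
      + (1 - 2 / p) * (1 - 2 / p - 1) * x ^ 2 * (x ^ p + y ^ q) ^ (1 - 2 / p - 1 - 1)
          * (p * x ^ (p - 1) * a + q * y ^ (q - 1) * b) ^ 2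
      + (1 - 2 / p) * x ^ 2 * (x ^ p + y ^ q) ^ (1 - 2 / p - 1)
          * (p * ((p - 1) * x ^ (p - 1 - 1) * a) * a + q * ((q - 1) * y ^ (q - 1 - 1) * b) * b)
      + A * (q * ((q - 1) * y ^ (q - 1 - 1) * b) * b) := by
  have hp0 : 0 < p := by linarith
  set th := 1 - 2 / p with hth
  have h0 : 0 ≤ th := by
    have : 2 / p ≤ 1 := by rw [div_le_one] <;> linarith
    linarith
  have hX : 0 < x ^ p := Real.rpow_pos_of_pos hx _
  have hY : 0 < y ^ q := Real.rpow_pos_of_pos hy _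
  set N := x ^ p + y ^ q with hN
  have hN0 : 0 < N := by positivity
  have ex1 : x ^ (p - 1) = x ^ p / x := Real.rpow_sub_one hx.ne' p
  have ex2 : x ^ (p - 1 - 1) = x ^ p / x / x := by rw [Real.rpow_sub_one hx.ne', ex1]
  have ey1 : y ^ (q - 1) = y ^ q / y := Real.rpow_sub_one hy.ne' q
  have ey2 : y ^ (q - 1 - 1) = y ^ q / y / y := by rw [Real.rpow_sub_one hy.ne', ey1]
  have en1 : N ^ (th - 1) = N ^ th / N := Real.rpow_sub_one hN0.ne' th
  have en2 : N ^ (th - 1 - 1) = N ^ th / N / N := by rw [Real.rpow_sub_one hN0.ne', en1]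
  have key := bell_alg p q th (x ^ p / N) (y ^ q / N) (a / x) (b / y) hp hq1 hq2 hth
    (by positivity) (by positivity) (by rw [← add_div, div_self hN0.ne'])
  rw [ex1, ex2, ey1, ey2, en1, en2]
  have hM : 0 < N ^ th := Real.rpow_pos_of_pos hN0 _
  set X := x ^ p
  set Y := y ^ q with hYdef
  set M := N ^ th with hMdef
  have key2 := mul_le_mul_of_nonneg_left key (show 0 ≤ x ^ 2 * M by positivity)
  have e2 : x ^ 2 * M * (2 * (a / x) ^ 2 + 4 * th * (a / x) * (p * (X / N) * (a / x) + q * (Y / N) * (b / y))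
      + th * (th - 1) * (p * (X / N) * (a / x) + q * (Y / N) * (b / y)) ^ 2
      + th * (p * (p - 1) * (X / N) * (a / x) ^ 2 + q * (q - 1) * (Y / N) * (b / y) ^ 2))
      = 2 * a ^ 2 * M
      + 4 * a * th * x * (M / N) * (p * (X / x) * a + q * (Y / y) * b)
      + th * (th - 1) * x ^ 2 * (M / N / N) * (p * (X / x) * a + q * (Y / y) * b) ^ 2
      + th * x ^ 2 * (M / N)
          * (p * ((p - 1) * (X / x / x) * a) * a + q * ((q - 1) * (Y / y / y) * b) * b) := by
    clear_value th M N X Y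
    field_simp
  rw [e2] at key2
  have e3 : A * (q * ((q - 1) * (Y / y / y) * b) * b) = 25 * (Y / y ^ 2) * b ^ 2 := by
    rw [← hA]; field_simp
  rw [e3]
  have l1 : x ^ 2 * (M / N) ≤ 1 := by
    have : M / N = N ^ (- (2 / p)) := by
      rw [hMdef, ← Real.rpow_sub_one hN0.ne']; congr 1; rw [hth]; ring
    rw [this, Real.rpow_neg hN0.le, ← div_eq_mul_inv, div_le_one (Real.rpow_pos_of_pos hN0 _)]
    have : x ^ 2 = (x ^ p) ^ (2 / p) := by
      rw [← Real.rpow_mul hx.le, mul_div_cancel₀ _ hp0.ne', Real.rpow_two]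
    rw [this]
    exact Real.rpow_le_rpow hX.le (by rw [hN]; linarith) (by positivity)
  have l2 : 1 ≤ M * (Y / y ^ 2) := by
    have m1 : Y ^ th ≤ M := Real.rpow_le_rpow hY.le (by rw [hN]; linarith) h0
    have m2 : Y ^ th * (Y / y ^ 2) = 1 := by
      rw [hYdef, ← Real.rpow_mul hy.le, ← Real.rpow_two y, ← Real.rpow_sub hy, ← Real.rpow_add hy]
      have : q * th + (q - 2) = 0 := by
        have h2 : 2 / p = 2 - 2 / q := by
          have : 2 / p = 2 * (1 / p) := by ring
          rw [this, eq_sub_of_add_eq hpq]; ring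
        have hq0 : q ≠ 0 := by linarith
        rw [hth, h2]; field_simp; ring
      rw [this, Real.rpow_zero]
    calc 1 = Y ^ th * (Y / y ^ 2) := m2.symm
      _ ≤ _ := mul_le_mul_of_nonneg_right m1 (by positivity)
  have l3 : x ^ 2 * M * ((a / x) ^ 2 - 24 * (Y / N) * (b / y) ^ 2)
      = M * a ^ 2 - 24 * (x ^ 2 * (M / N)) * ((Y / y ^ 2) * b ^ 2) := by
    field_simp
  have l4 : (x ^ 2 * (M / N)) * ((Y / y ^ 2) * b ^ 2) ≤ 1 * ((Y / y ^ 2) * b ^ 2) :=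
    mul_le_mul_of_nonneg_right l1 (by positivity)
  have l5 : 2 * |a * b| ≤ M * a ^ 2 + (Y / y ^ 2) * b ^ 2 := by
    have t1 : |a * b| ^ 2 ≤ (M * a ^ 2) * ((Y / y ^ 2) * b ^ 2) := by
      rw [sq_abs]
      have := mul_le_mul_of_nonneg_right l2 (sq_nonneg (a * b))
      calc (a * b) ^ 2 = 1 * (a * b) ^ 2 := by ring
        _ ≤ _ := this
        _ = _ := by ring
    have t2 : (2 * |a * b|) ^ 2 ≤ (M * a ^ 2 + (Y / y ^ 2) * b ^ 2) ^ 2 := by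
      have := sq_nonneg (M * a ^ 2 - (Y / y ^ 2) * b ^ 2)
      generalize M * a ^ 2 = m at *
      generalize Y / y ^ 2 * b ^ 2 = n at *
      generalize |a * b| = l at *
      nlinarith
    exact abs_le_of_sq_le_sq' t2 (by positivity) |>.2
  rw [l3] at key2
  linarith

lemma bell_mid_pos (p q A : ℝ) (hp : 2 ≤ p) (hq1 : 1 < q) (hq2 : q ≤ 2)
    (hpq : 1 / p + 1 / q = 1) (hA : A * (q * (q - 1)) = 25) (x x' y y' : ℝ)
    (hx : 0 < x) (hx' : 0 < x') (hy : 0 < y) (hy' : 0 < y') :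
    bell p q A ((x + x') / 2) ((y + y') / 2) + |x - x'| * |y - y'| / 4
      ≤ (bell p q A x y + bell p q A x' y') / 2 := by
  set a := x' - x with ha
  set b := y' - y with hb
  have posx : ∀ s ∈ Icc (0:ℝ) 1, 0 < x + s * a := by
    intro s hs
    have : x + s * a = (1 - s) * x + s * x' := by rw [ha]; ring
    rw [this]
    rcases eq_or_lt_of_le hs.1 with h | h
    · rw [← h]; simpa
    · have : 0 ≤ (1 - s) * x := mul_nonneg (by linarith [hs.2]) hx.le
      positivity
  have posy : ∀ s ∈ Icc (0:ℝ) 1, 0 < y + s * b := by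
    intro s hs
    have : y + s * b = (1 - s) * y + s * y' := by rw [hb]; ring
    rw [this]
    rcases eq_or_lt_of_le hs.1 with h | h
    · rw [← h]; simpa
    · have : 0 ≤ (1 - s) * y := mul_nonneg (by linarith [hs.2]) hy.le
      positivity
  have dx : ∀ s : ℝ, HasDerivAt (fun s : ℝ => x + s * a) a s := fun s => by
    simpa using ((hasDerivAt_id s).mul_const a).const_add x
  have dy : ∀ s : ℝ, HasDerivAt (fun s : ℝ => y + s * b) b s := fun s => by
    simpa using ((hasDerivAt_id s).mul_const b).const_add y
  have dX : ∀ (r : ℝ), ∀ s ∈ Icc (0:ℝ) 1, HasDerivAt (fun s : ℝ => (x + s * a) ^ r)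
      (r * (x + s * a) ^ (r - 1) * a) s := fun r s hs => by
    have := (dx s).rpow_const (p := r) (Or.inl (posx s hs).ne')
    exact this.congr_deriv (by ring)
  have dY : ∀ (r : ℝ), ∀ s ∈ Icc (0:ℝ) 1, HasDerivAt (fun s : ℝ => (y + s * b) ^ r)
      (r * (y + s * b) ^ (r - 1) * b) s := fun r s hs => by
    have := (dy s).rpow_const (p := r) (Or.inl (posy s hs).ne')
    exact this.congr_deriv (by ring)
  have posN : ∀ s ∈ Icc (0:ℝ) 1, 0 < (x + s * a) ^ p + (y + s * b) ^ q := fun s hs =>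
    add_pos (Real.rpow_pos_of_pos (posx s hs) _) (Real.rpow_pos_of_pos (posy s hs) _)
  have dN : ∀ s ∈ Icc (0:ℝ) 1, HasDerivAt (fun s : ℝ => (x + s * a) ^ p + (y + s * b) ^ q)
      (p * (x + s * a) ^ (p - 1) * a + q * (y + s * b) ^ (q - 1) * b) s := fun s hs =>
    (dX p s hs).add (dY q s hs)
  have dN' : ∀ s ∈ Icc (0:ℝ) 1, HasDerivAt
      (fun s : ℝ => p * (x + s * a) ^ (p - 1) * a + q * (y + s * b) ^ (q - 1) * b)
      (p * ((p - 1) * (x + s * a) ^ (p - 1 - 1) * a) * a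
        + q * ((q - 1) * (y + s * b) ^ (q - 1 - 1) * b) * b) s := fun s hs =>
    (((dX (p - 1) s hs).const_mul p).mul_const a).add (((dY (q - 1) s hs).const_mul q).mul_const b)
  have dNr : ∀ (r : ℝ), ∀ s ∈ Icc (0:ℝ) 1,
      HasDerivAt (fun s : ℝ => ((x + s * a) ^ p + (y + s * b) ^ q) ^ r)
      ((p * (x + s * a) ^ (p - 1) * a + q * (y + s * b) ^ (q - 1) * b) * r *
        ((x + s * a) ^ p + (y + s * b) ^ q) ^ (r - 1)) s := fun r s hs =>
    (dN s hs).rpow_const (Or.inl (posN s hs).ne')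
  have main := midpoint_of_deriv2
    (fun s => (x + s * a) ^ 2 * ((x + s * a) ^ p + (y + s * b) ^ q) ^ (1 - 2 / p)
      + A * (y + s * b) ^ q)
    (fun s => (2 * (x + s * a) * a) * ((x + s * a) ^ p + (y + s * b) ^ q) ^ (1 - 2 / p)
      + (x + s * a) ^ 2 * ((p * (x + s * a) ^ (p - 1) * a + q * (y + s * b) ^ (q - 1) * b)
        * (1 - 2 / p) * ((x + s * a) ^ p + (y + s * b) ^ q) ^ (1 - 2 / p - 1))
      + A * (q * (y + s * b) ^ (q - 1) * b))
    (fun s => 2 * a ^ 2 * ((x + s * a) ^ p + (y + s * b) ^ q) ^ (1 - 2 / p)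
      + 4 * a * (1 - 2 / p) * (x + s * a) * ((x + s * a) ^ p + (y + s * b) ^ q) ^ (1 - 2 / p - 1) *
          (p * (x + s * a) ^ (p - 1) * a + q * (y + s * b) ^ (q - 1) * b)
      + (1 - 2 / p) * (1 - 2 / p - 1) * (x + s * a) ^ 2
          * ((x + s * a) ^ p + (y + s * b) ^ q) ^ (1 - 2 / p - 1 - 1)
          * (p * (x + s * a) ^ (p - 1) * a + q * (y + s * b) ^ (q - 1) * b) ^ 2
      + (1 - 2 / p) * (x + s * a) ^ 2 * ((x + s * a) ^ p + (y + s * b) ^ q) ^ (1 - 2 / p - 1)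
          * (p * ((p - 1) * (x + s * a) ^ (p - 1 - 1) * a) * a
            + q * ((q - 1) * (y + s * b) ^ (q - 1 - 1) * b) * b)
      + A * (q * ((q - 1) * (y + s * b) ^ (q - 1 - 1) * b) * b))
    |a * b| ?_ ?_ ?_
  · have e0 : |x| = x := abs_of_pos hx
    have e1 : |y| = y := abs_of_pos hy
    have e2 : |x'| = x' := abs_of_pos hx'
    have e3 : |y'| = y' := abs_of_pos hy'
    have e4 : |(x + x') / 2| = (x + x') / 2 := abs_of_pos (by positivity)
    have e5 : |(y + y') / 2| = (y + y') / 2 := abs_of_pos (by positivity)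
    have f0 : x + 1 / 2 * a = (x + x') / 2 := by rw [ha]; ring
    have f1 : y + 1 / 2 * b = (y + y') / 2 := by rw [hb]; ring
    have f2 : x + 1 * a = x' := by rw [ha]; ring
    have f3 : y + 1 * b = y' := by rw [hb]; ring
    have f4 : |a * b| = |x - x'| * |y - y'| := by
      rw [abs_mul, ha, hb, abs_sub_comm x, abs_sub_comm y]
    simp only [f0, f1, f2, f3, f4, zero_mul, add_zero] at main
    simp only [bell, e0, e1, e2, e3, e4, e5]
    exact main
  · intro s hs
    have h1 : HasDerivAt (fun s : ℝ => (x + s * a) ^ 2) (2 * (x + s * a) * a) s :=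
      ((dx s).pow 2).congr_deriv (by simp)
    exact (h1.mul (dNr (1 - 2 / p) s hs)).add ((dY q s hs).const_mul A)
  · intro s hs
    have h1 : HasDerivAt (fun s : ℝ => (x + s * a) ^ 2) (2 * (x + s * a) * a) s :=
      ((dx s).pow 2).congr_deriv (by simp)
    have h2 : HasDerivAt (fun s : ℝ => 2 * (x + s * a) * a) (2 * a * a) s :=
      ((dx s).const_mul 2).mul_const a
    have := ((h2.mul (dNr (1 - 2 / p) s hs)).add
      (h1.mul (((dN' s hs).mul_const (1 - 2 / p)).mul (dNr (1 - 2 / p - 1) s hs)))).add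
      ((((dY (q - 1) s hs).const_mul q).mul_const b).const_mul A)
    refine this.congr_deriv ?_
    simp only [Pi.mul_apply]
    generalize ((x + s * a) ^ p + (y + s * b) ^ q) ^ (1 - 2 / p) = N0
    generalize ((x + s * a) ^ p + (y + s * b) ^ q) ^ (1 - 2 / p - 1) = N1
    generalize ((x + s * a) ^ p + (y + s * b) ^ q) ^ (1 - 2 / p - 1 - 1) = N2
    generalize (1 - 2 / p) = th
    generalize (x + s * a) ^ (p - 1 - 1) = X2
    generalize (y + s * b) ^ (q - 1 - 1) = Y2
    generalize (x + s * a) ^ (p - 1) = X1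
    generalize (y + s * b) ^ (q - 1) = Y1
    ring
  · intro s hs
    exact bell_hess p q A _ _ a b hp hq1 hq2 hpq hA (posx s hs) (posy s hs)

lemma bell_mid (p q A : ℝ) (hp : 2 ≤ p) (hq1 : 1 < q) (hq2 : q ≤ 2)
    (hpq : 1 / p + 1 / q = 1) (hA : A * (q * (q - 1)) = 25) (x x' y y' : ℝ)
    (hx : 0 ≤ x) (hx' : 0 ≤ x') (hy : 0 ≤ y) (hy' : 0 ≤ y') :
    bell p q A ((x + x') / 2) ((y + y') / 2) + |x - x'| * |y - y'| / 4
      ≤ (bell p q A x y + bell p q A x' y') / 2 := by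
  have hc := bell_continuous p q A hp (by linarith)
  have c1 : Continuous (fun e : ℝ => bell p q A ((x + e + (x' + e)) / 2) ((y + e + (y' + e)) / 2)
      + |x + e - (x' + e)| * |y + e - (y' + e)| / 4) := by
    have : Continuous (fun e : ℝ => bell p q A ((x + e + (x' + e)) / 2) ((y + e + (y' + e)) / 2)) :=
      hc.comp (f := fun e : ℝ => ((x + e + (x' + e)) / 2, (y + e + (y' + e)) / 2)) (by fun_prop)
    fun_prop
  have c2 : Continuous (fun e : ℝ => (bell p q A (x + e) (y + e)
      + bell p q A (x' + e) (y' + e)) / 2) := by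
    have h1 : Continuous (fun e : ℝ => bell p q A (x + e) (y + e)) :=
      hc.comp (f := fun e : ℝ => (x + e, y + e)) (by fun_prop)
    have h2 : Continuous (fun e : ℝ => bell p q A (x' + e) (y' + e)) :=
      hc.comp (f := fun e : ℝ => (x' + e, y' + e)) (by fun_prop)
    fun_prop
  have t1 := (c1.tendsto 0).mono_left (nhdsWithin_le_nhds (s := Ioi 0))
  have t2 := (c2.tendsto 0).mono_left (nhdsWithin_le_nhds (s := Ioi 0))
  have := le_of_tendsto_of_tendsto t1 t2 (by
    filter_upwards [self_mem_nhdsWithin] with e he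
    have he : 0 < e := he
    exact bell_mid_pos p q A hp hq1 hq2 hpq hA _ _ _ _ (by positivity) (by positivity)
      (by positivity) (by positivity))
  simpa using this

/-- Abstract Bellman function: all that is used later. -/
structure IsBell (p q : ℝ) (Q : ℝ → ℝ → ℝ) (C : ℝ) : Prop where
  cont : Continuous (fun z : ℝ × ℝ => Q z.1 z.2)
  nonneg : ∀ x y, 0 ≤ Q x y
  le : ∀ x y, Q x y ≤ C * (|x| ^ p + |y| ^ q)
  mid : ∀ x x' y y', 0 ≤ x → 0 ≤ x' → 0 ≤ y → 0 ≤ y' →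
    Q ((x + x') / 2) ((y + y') / 2) + |x - x'| * |y - y'| / 4 ≤ (Q x y + Q x' y') / 2

lemma exists_bell_ge (p q : ℝ) (hp : 2 ≤ p) (hpq : 1 / p + 1 / q = 1) (hq1 : 1 < q) :
    ∃ Q C, 0 < C ∧ IsBell p q Q C := by
  have hp0 : 0 < p := by linarith
  have hq2 : q ≤ 2 := by
    have : 1 / p ≤ 1 / 2 := one_div_le_one_div_of_le (by norm_num) hp
    have h : 1 / 2 ≤ 1 / q := by linarith
    exact (one_div_le_one_div (by norm_num) (by linarith)).1 h
  have hq0 : 0 < q * (q - 1) := mul_pos (by linarith) (by linarith)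
  have hA0 : 0 < 25 / (q * (q - 1)) := by positivity
  have hth : 0 ≤ 1 - 2 / p := by
    have : 2 / p ≤ 1 := by rw [div_le_one] <;> linarith
    linarith
  refine ⟨bell p q (25 / (q * (q - 1))), 1 + 25 / (q * (q - 1)), by positivity,
    bell_continuous _ _ _ hp (by linarith), ?_, ?_, ?_⟩
  · intro x y
    unfold bell
    positivity
  · intro x y
    unfold bell
    set N := |x| ^ p + |y| ^ q with hN
    have hx0 : 0 ≤ |x| ^ p := by positivity
    have hy0 : 0 ≤ |y| ^ q := by positivity
    have hN0 : 0 ≤ N := by positivity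
    have h1 : x ^ 2 * N ^ (1 - 2 / p) ≤ N := by
      have e : x ^ 2 = (|x| ^ p) ^ (2 / p) := by
        rw [← Real.rpow_mul (abs_nonneg x), mul_div_cancel₀ _ hp0.ne', Real.rpow_two, sq_abs]
      have h2 : x ^ 2 ≤ N ^ (2 / p) := by
        rw [e]; exact Real.rpow_le_rpow hx0 (by linarith) (by positivity)
      calc x ^ 2 * N ^ (1 - 2 / p) ≤ N ^ (2 / p) * N ^ (1 - 2 / p) :=
            mul_le_mul_of_nonneg_right h2 (by positivity)
        _ = N := by
            rw [← Real.rpow_add_of_nonneg hN0 (by positivity) hth]; simp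
    have h2 : 25 / (q * (q - 1)) * |y| ^ q ≤ 25 / (q * (q - 1)) * N :=
      mul_le_mul_of_nonneg_left (by linarith) hA0.le
    linarith
  · intro x x' y y' hx hx' hy hy'
    exact bell_mid p q _ hp hq1 hq2 hpq (div_mul_cancel₀ _ hq0.ne') x x' y y' hx hx' hy hy'

lemma exists_bell (p q : ℝ) (hp : 1 < p) (hq : 1 < q) (hpq : 1 / p + 1 / q = 1) :
    ∃ Q C, 0 < C ∧ IsBell p q Q C := by
  rcases le_total 2 p with h | h
  · exact exists_bell_ge p q h hpq hq
  · have hq2 : 2 ≤ q := by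
      have : 1 / 2 ≤ 1 / p := one_div_le_one_div_of_le (by linarith) h
      have h : 1 / q ≤ 1 / 2 := by linarith
      exact (one_div_le_one_div (by linarith) (by norm_num)).1 h
    obtain ⟨Q, C, hC, hQ⟩ := exists_bell_ge q p hq2 (by linarith) hp
    refine ⟨fun x y => Q y x, C, hC, ?_, fun x y => hQ.nonneg y x, ?_, ?_⟩
    · exact hQ.cont.comp (f := fun z : ℝ × ℝ => (z.2, z.1)) (by fun_prop)
    · intro x y; rw [add_comm]; exact hQ.le y x
    · intro x x' y y' hx hx' hy hy'
      rw [mul_comm]; exact hQ.mid y y' x x' hy hy' hx hx'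

/-- continuous with compact support -/
def CC (f : E2 → ℝ) : Prop := Continuous f ∧ HasCompactSupport f

lemma CC.integrable {f : E2 → ℝ} (h : CC f) : Integrable f volume :=
  h.1.integrable_of_hasCompactSupport h.2

lemma CC.add {f g : E2 → ℝ} (hf : CC f) (hg : CC g) : CC (f + g) := ⟨hf.1.add hg.1, hf.2.add hg.2⟩
lemma CC.neg {f : E2 → ℝ} (hf : CC f) : CC (-f) := ⟨hf.1.neg, hf.2.neg⟩
lemma CC.sub {f g : E2 → ℝ} (hf : CC f) (hg : CC g) : CC (f - g) := by
  rw [sub_eq_add_neg]; exact hf.add hg.neg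
lemma CC.smul {f : E2 → ℝ} (c : ℝ) (hf : CC f) : CC (c • f) :=
  ⟨hf.1.const_smul c, hf.2.smul_left (f := fun _ => c)⟩
lemma CC.mul {f g : E2 → ℝ} (hf : CC f) (hg : CC g) : CC (fun x => f x * g x) :=
  ⟨hf.1.mul hg.1, hf.2.mul_right⟩
lemma CC.comp {f : E2 → ℝ} (hf : CC f) {φ : ℝ → ℝ} (hφ : Continuous φ) (h0 : φ 0 = 0) :
    CC (fun x => φ (f x)) := ⟨hφ.comp hf.1, hf.2.comp_left h0⟩
lemma CC.abs {f : E2 → ℝ} (hf : CC f) : CC (fun x => |f x|) := hf.comp continuous_abs abs_zero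
lemma CC.comp₂ {f g : E2 → ℝ} (hf : CC f) (hg : CC g) {Q : ℝ → ℝ → ℝ}
    (hQ : Continuous (fun z : ℝ × ℝ => Q z.1 z.2)) (h0 : Q 0 0 = 0) :
    CC (fun x => Q (f x) (g x)) :=
  ⟨hQ.comp (hf.1.prodMk hg.1), hf.2.comp₂_left hg.2 h0⟩

/-- translation -/
def T (v : E2) : Module.End ℝ (E2 → ℝ) where
  toFun f := fun x => f (x + v)
  map_add' _ _ := rfl
  map_smul' _ _ := rfl

@[simp] lemma T_apply (v : E2) (f : E2 → ℝ) (x : E2) : T v f x = f (x + v) := rfl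

lemma T_comm (v w : E2) : Commute (T v) (T w) := by
  ext f x
  simp [add_right_comm]

lemma CC.T {f : E2 → ℝ} (hf : CC f) (v : E2) : CC (T v f) :=
  ⟨hf.1.comp (by fun_prop), hf.2.comp_homeomorph (Homeomorph.addRight v)⟩

lemma integral_T (f : E2 → ℝ) (v : E2) : ∫ x, T v f x = ∫ x, f x :=
  integral_add_right_eq_self f v

lemma integral_T_mul (f g : E2 → ℝ) (v : E2) : ∫ x, T v f x * g x = ∫ x, f x * T (-v) g x := by
  have := integral_add_right_eq_self (μ := (volume : Measure E2)) (fun x => f x * g (x + -v)) v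
  simpa using this

/-- centred difference -/
def dl (v : E2) : Module.End ℝ (E2 → ℝ) := T v - T (-v)

lemma dl_apply (v : E2) (f : E2 → ℝ) (x : E2) : dl v f x = f (x + v) - f (x - v) := by
  simp [dl, sub_eq_add_neg]

lemma CC.dl {f : E2 → ℝ} (hf : CC f) (v : E2) : CC (dl v f) := (hf.T v).sub (hf.T (-v))

lemma integral_dl_dl (v : E2) {f k : E2 → ℝ} (hf : CC f) (hk : CC k) :
    ∫ x, dl v (dl v f) x * k x = - ∫ x, dl v f x * dl v k x := by
  set g := dl v f with hg
  have hgc : CC g := hf.dl v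
  have e1 : ∀ x, dl v g x * k x = T v g x * k x - T (-v) g x * k x := fun x => by
    simp [dl]; ring
  have e2 : ∀ x, g x * dl v k x = g x * T v k x - g x * T (-v) k x := fun x => by
    simp [dl]; ring
  simp only [e1, e2]
  rw [integral_sub ((hgc.T v).mul hk).integrable ((hgc.T (-v)).mul hk).integrable,
    integral_sub (hgc.mul (hk.T v)).integrable (hgc.mul (hk.T (-v))).integrable,
    integral_T_mul, integral_T_mul]
  simp

/-- averaging operator -/
def P (v : Fin 4 → E2) : Module.End ℝ (E2 → ℝ) := (1/8 : ℝ) • ∑ j, (T (v j) + T (-v j))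

lemma P_apply (v : Fin 4 → E2) (f : E2 → ℝ) (x : E2) :
    P v f x = (1/8 : ℝ) * ∑ j, (f (x + v j) + f (x - v j)) := by
  simp [P, sub_eq_add_neg]

lemma P_comm_T (v : Fin 4 → E2) (w : E2) : Commute (P v) (T w) := by
  unfold P
  apply Commute.smul_left
  apply Commute.sum_left
  intro j _
  exact (T_comm _ _).add_left (T_comm _ _)

lemma P_comm_dl (v : Fin 4 → E2) (w : E2) : Commute (P v) (dl w) :=
  (P_comm_T v w).sub_right (P_comm_T v (-w))

lemma CC.P {f : E2 → ℝ} (hf : CC f) (v : Fin 4 → E2) : CC (P v f) := by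
  have : _root_.P v f = (1/8 : ℝ) • ((_root_.T (v 0) f + _root_.T (-v 0) f) + (_root_.T (v 1) f + _root_.T (-v 1) f)
      + (_root_.T (v 2) f + _root_.T (-v 2) f) + (_root_.T (v 3) f + _root_.T (-v 3) f)) := by
    simp [_root_.P, Fin.sum_univ_four]
  rw [this]
  exact (((((hf.T _).add (hf.T _)).add ((hf.T _).add (hf.T _))).add
    ((hf.T _).add (hf.T _))).add ((hf.T _).add (hf.T _))).smul _

lemma CC.Pn {f : E2 → ℝ} (hf : CC f) (v : Fin 4 → E2) (n : ℕ) : CC ((_root_.P v ^ n) f) := by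
  induction n with
  | zero => simpa
  | succ n ih => rw [pow_succ']; exact CC.P ih v

lemma P_nonneg (v : Fin 4 → E2) {f : E2 → ℝ} (hf : ∀ x, 0 ≤ f x) (x : E2) : 0 ≤ P v f x := by
  rw [P_apply]
  have : 0 ≤ ∑ j, (f (x + v j) + f (x - v j)) :=
    Finset.sum_nonneg fun j _ => add_nonneg (hf _) (hf _)
  positivity

lemma Pn_nonneg (v : Fin 4 → E2) {f : E2 → ℝ} (hf : ∀ x, 0 ≤ f x) (n : ℕ) :
    ∀ x, 0 ≤ (P v ^ n) f x := by
  induction n with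
  | zero => simpa
  | succ n ih => rw [pow_succ']; exact P_nonneg v ih

lemma P_bound (v : Fin 4 → E2) {f : E2 → ℝ} {M : ℝ} (hf : ∀ x, |f x| ≤ M) (x : E2) :
    |P v f x| ≤ M := by
  rw [P_apply, Fin.sum_univ_four]
  have h := fun y => abs_le.1 (hf y)
  rw [abs_le]
  constructor <;>
  linarith [h (x + v 0), h (x - v 0), h (x + v 1), h (x - v 1), h (x + v 2), h (x - v 2),
    h (x + v 3), h (x - v 3), (h (x + v 0)).1, (h (x - v 0)).1, (h (x + v 1)).1, (h (x - v 1)).1,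
    (h (x + v 2)).1, (h (x - v 2)).1, (h (x + v 3)).1, (h (x - v 3)).1, (h (x + v 0)).2,
    (h (x - v 0)).2, (h (x + v 1)).2, (h (x - v 1)).2,
    (h (x + v 2)).2, (h (x - v 2)).2, (h (x + v 3)).2, (h (x - v 3)).2]

lemma Pn_bound (v : Fin 4 → E2) {f : E2 → ℝ} {M : ℝ} (hf : ∀ x, |f x| ≤ M) (n : ℕ) :
    ∀ x, |(P v ^ n) f x| ≤ M := by
  induction n with
  | zero => simpa
  | succ n ih => rw [pow_succ']; exact P_bound v ih

lemma integral_P (v : Fin 4 → E2) {f : E2 → ℝ} (hf : CC f) : ∫ x, P v f x = ∫ x, f x := by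
  simp only [P_apply]
  rw [integral_const_mul, integral_finsetSum]
  · have : ∀ j, ∫ x, (f (x + v j) + f (x - v j)) = 2 * ∫ x, f x := fun j => by
      rw [integral_add (f := fun x => f (x + v j)) (hf.T (v j)).integrable
        (by simpa [T, sub_eq_add_neg] using (hf.T (-v j)).integrable)]
      rw [integral_add_right_eq_self f, integral_sub_right_eq_self f]
      ring
    simp only [this]
    simp
    ring
  · intro j _
    exact (hf.T (v j)).integrable.add
        (by simpa [T, sub_eq_add_neg] using (hf.T (-v j)).integrable)

lemma integral_Pn (v : Fin 4 → E2) {f : E2 → ℝ} (hf : CC f) (n : ℕ) :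
    ∫ x, (P v ^ n) f x = ∫ x, f x := by
  induction n with
  | zero => simp
  | succ n ih => rw [pow_succ']; exact (integral_P v (hf.Pn v n)).trans ih

lemma integral_P_mul (v : Fin 4 → E2) {f g : E2 → ℝ} (hf : CC f) (hg : CC g) :
    ∫ x, P v f x * g x = ∫ x, f x * P v g x := by
  have e1 : ∀ x, P v f x * g x = (1/8:ℝ) * ∑ j, (T (v j) f x * g x + T (-v j) f x * g x) := by
    intro x; simp [P, Finset.sum_mul, add_mul, mul_assoc]
  have e2 : ∀ x, f x * P v g x = (1/8:ℝ) * ∑ j, (f x * T (v j) g x + f x * T (-v j) g x) := by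
    intro x; simp [P, Finset.mul_sum, mul_add, mul_left_comm]
  simp only [e1, e2]
  rw [integral_const_mul, integral_const_mul, integral_finsetSum, integral_finsetSum]
  · congr 1
    refine Finset.sum_congr rfl fun j _ => ?_
    rw [integral_add ((hf.T _).mul hg).integrable ((hf.T _).mul hg).integrable,
      integral_add (hf.mul (hg.T _)).integrable (hf.mul (hg.T _)).integrable,
      integral_T_mul, integral_T_mul, neg_neg, add_comm]
  · intro j _
    exact (hf.mul (hg.T _)).integrable.add (hf.mul (hg.T _)).integrable
  · intro j _
    exact ((hf.T _).mul hg).integrable.add ((hf.T _).mul hg).integrable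

/-- one step of dissipation -/
lemma dissipation (v : Fin 4 → E2) {Q : ℝ → ℝ → ℝ} {f g : E2 → ℝ}
    (hQ : Continuous (fun z : ℝ × ℝ => Q z.1 z.2)) (h0 : Q 0 0 = 0) (hf : CC f) (hg : CC g)
    (S : Set ℝ) (hS : Convex ℝ S) (hfS : ∀ x, f x ∈ S) (hgS : ∀ x, g x ∈ S)
    (mid : ∀ x x' y y', x ∈ S → x' ∈ S → y ∈ S → y' ∈ S →
      Q ((x + x') / 2) ((y + y') / 2) + |x - x'| * |y - y'| / 4 ≤ (Q x y + Q x' y') / 2) :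
    ∫ x, Q (P v f x) (P v g x) + (1/16 : ℝ) * ∑ j, |dl (v j) f x| * |dl (v j) g x| ≤
      ∫ x, Q (f x) (g x) := by
  have hmS : ∀ a b, a ∈ S → b ∈ S → (a + b) / 2 ∈ S := fun a b ha hb => by
    have := hS ha hb (show (0:ℝ) ≤ 1/2 by norm_num) (show (0:ℝ) ≤ 1/2 by norm_num) (by norm_num)
    convert this using 1
    simp only [smul_eq_mul]; ring
  have mid' : ∀ x x' y y', x ∈ S → x' ∈ S → y ∈ S → y' ∈ S →
      Q ((x + x') / 2) ((y + y') / 2) ≤ (Q x y + Q x' y') / 2 := fun x x' y y' a b c d => by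
    have := mid x x' y y' a b c d
    have : 0 ≤ |x - x'| * |y - y'| / 4 := by positivity
    linarith
  have hQc : CC (fun x => Q (f x) (g x)) := hf.comp₂ hg hQ h0
  rw [← integral_P v hQc]
  have hI : Integrable (fun x => ∑ j, |dl (v j) f x| * |dl (v j) g x|) volume :=
    integrable_finsetSum _ fun j _ => ((hf.dl (v j)).abs.mul (hg.dl (v j)).abs).integrable
  apply integral_mono
  · exact (((hf.P v).comp₂ (hg.P v) hQ h0).integrable).add (hI.const_mul _)
  · exact (hQc.P v).integrable
  · intro x
    simp only
    rw [P_apply, P_apply, P_apply]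
    simp only [Fin.sum_univ_four, dl_apply]
    have k := fun j => mid (f (x + v j)) (f (x - v j)) (g (x + v j)) (g (x - v j))
      (hfS _) (hfS _) (hgS _) (hgS _)
    have mf := fun j => hmS _ _ (hfS (x + v j)) (hfS (x - v j))
    have mg := fun j => hmS _ _ (hgS (x + v j)) (hgS (x - v j))
    have m1 := mid' _ _ _ _ (mf 0) (mf 1) (mg 0) (mg 1)
    have m2 := mid' _ _ _ _ (mf 2) (mf 3) (mg 2) (mg 3)
    have m3 := mid' _ _ _ _ (hmS _ _ (mf 0) (mf 1)) (hmS _ _ (mf 2) (mf 3))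
      (hmS _ _ (mg 0) (mg 1)) (hmS _ _ (mg 2) (mg 3))
    have ef : (1/8 : ℝ) * (f (x + v 0) + f (x - v 0) + (f (x + v 1) + f (x - v 1))
      + (f (x + v 2) + f (x - v 2)) + (f (x + v 3) + f (x - v 3)))
      = (((f (x + v 0) + f (x - v 0)) / 2 + (f (x + v 1) + f (x - v 1)) / 2) / 2
        + ((f (x + v 2) + f (x - v 2)) / 2 + (f (x + v 3) + f (x - v 3)) / 2) / 2) / 2 := by ring
    have eg : (1/8 : ℝ) * (g (x + v 0) + g (x - v 0) + (g (x + v 1) + g (x - v 1))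
      + (g (x + v 2) + g (x - v 2)) + (g (x + v 3) + g (x - v 3)))
      = (((g (x + v 0) + g (x - v 0)) / 2 + (g (x + v 1) + g (x - v 1)) / 2) / 2
        + ((g (x + v 2) + g (x - v 2)) / 2 + (g (x + v 3) + g (x - v 3)) / 2) / 2) / 2 := by ring
    rw [ef, eg]
    have k0 := k 0
    have k1 := k 1
    have k2 := k 2
    have k3 := k 3
    linarith

lemma dissipation_sum (v : Fin 4 → E2) {Q : ℝ → ℝ → ℝ} {f g : E2 → ℝ}
    (hQ : Continuous (fun z : ℝ × ℝ => Q z.1 z.2)) (h0 : Q 0 0 = 0) (hQ0 : ∀ x y, 0 ≤ Q x y)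
    (hf : CC f) (hg : CC g)
    (S : Set ℝ) (hS : Convex ℝ S) (hfS : ∀ n x, (P v ^ n) f x ∈ S) (hgS : ∀ n x, (P v ^ n) g x ∈ S)
    (mid : ∀ x x' y y', x ∈ S → x' ∈ S → y ∈ S → y' ∈ S →
      Q ((x + x') / 2) ((y + y') / 2) + |x - x'| * |y - y'| / 4 ≤ (Q x y + Q x' y') / 2) (N : ℕ) :
    ∑ n ∈ Finset.range N, ∑ j, ∫ x, |dl (v j) ((P v ^ n) f) x| * |dl (v j) ((P v ^ n) g) x| ≤
      16 * ∫ x, Q (f x) (g x) := by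
  have key : ∀ N : ℕ, ∑ n ∈ Finset.range N, ∑ j,
      ∫ x, |dl (v j) ((P v ^ n) f) x| * |dl (v j) ((P v ^ n) g) x| ≤
      16 * (∫ x, Q (f x) (g x)) - 16 * ∫ x, Q ((P v ^ N) f x) ((P v ^ N) g x) := by
    intro N
    induction N with
    | zero => simp
    | succ N ih =>
      rw [Finset.sum_range_succ]
      have hfN := hf.Pn v N
      have hgN := hg.Pn v N
      have d := dissipation v hQ h0 hfN hgN S hS (hfS N) (hgS N) mid
      have hI : ∀ j, Integrable (fun x => |dl (v j) ((P v ^ N) f) x| * |dl (v j) ((P v ^ N) g) x|)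
        volume := fun j => ((hfN.dl (v j)).abs.mul (hgN.dl (v j)).abs).integrable
      rw [integral_add (((hfN.P v).comp₂ (hgN.P v) hQ h0).integrable)
        ((integrable_finsetSum _ fun j _ => hI j).const_mul _), integral_const_mul,
        integral_finsetSum _ (fun j _ => hI j)] at d
      rw [pow_succ']
      simp only [Module.End.mul_apply]
      linarith
  have := key N
  have h2 : 0 ≤ ∫ x, Q ((P v ^ N) f x) ((P v ^ N) g x) := integral_nonneg fun x => hQ0 _ _
  linarith

/-- quadratic energy -/
def qq (x y : ℝ) : ℝ := (x ^ 2 + y ^ 2) / 2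

lemma qq_mid (x x' y y' : ℝ) :
    qq ((x + x') / 2) ((y + y') / 2) + |x - x'| * |y - y'| / 4 ≤ (qq x y + qq x' y') / 2 := by
  unfold qq
  have h := sq_nonneg (|x - x'| - |y - y'|)
  have h1 := sq_abs (x - x')
  have h2 := sq_abs (y - y')
  nlinarith

lemma qq_self (x : ℝ) : qq x x = x ^ 2 := by unfold qq; ring

lemma qq_cont : Continuous (fun z : ℝ × ℝ => qq z.1 z.2) := by unfold qq; fun_prop

lemma CC.sq {f : E2 → ℝ} (hf : CC f) : CC (fun x => f x ^ 2) :=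
  hf.comp (φ := fun t => t ^ 2) (by fun_prop) (by simp)

lemma integral_P_sq_le (v : Fin 4 → E2) {f : E2 → ℝ} (hf : CC f) :
    ∫ x, P v f x ^ 2 ≤ ∫ x, f x ^ 2 := by
  have := dissipation v qq_cont (by simp [qq]) hf hf univ convex_univ (by simp) (by simp)
    (fun x x' y y' _ _ _ _ => qq_mid x x' y y')
  simp only [qq_self] at this
  refine le_trans (integral_mono (hf.P v).sq.integrable ?_ ?_) this
  · exact (hf.P v).sq.integrable.add ((integrable_finsetSum _ fun j _ =>
      ((hf.dl (v j)).abs.mul (hf.dl (v j)).abs).integrable).const_mul _)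
  · intro x
    have : 0 ≤ ∑ j, |dl (v j) f x| * |dl (v j) f x| := Finset.sum_nonneg fun j _ => by positivity
    simp only
    linarith

lemma integral_Pn_sq_le (v : Fin 4 → E2) {f : E2 → ℝ} (hf : CC f) (n : ℕ) :
    ∫ x, (P v ^ n) f x ^ 2 ≤ ∫ x, f x ^ 2 := by
  induction n with
  | zero => simp
  | succ n ih => rw [pow_succ']; exact (integral_P_sq_le v (hf.Pn v n)).trans ih

lemma P_dl (v : Fin 4 → E2) (w : E2) (n : ℕ) (f : E2 → ℝ) :
    (P v ^ n) (dl w f) = dl w ((P v ^ n) f) := by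
  have := ((P_comm_dl v w).pow_left n).eq
  exact congrArg (fun A : Module.End ℝ (E2 → ℝ) => A f) this

lemma energy_decay (v : Fin 4 → E2) {f : E2 → ℝ} (hf : CC f) (i : Fin 4) (N : ℕ) :
    N * ∫ x, dl (v i) ((P v ^ N) f) x ^ 2 ≤ 16 * ∫ x, f x ^ 2 := by
  have h := dissipation_sum v qq_cont (by simp [qq]) (fun x y => by unfold qq; positivity)
    hf hf univ convex_univ (by simp) (by simp)
    (fun x x' y y' _ _ _ _ => qq_mid x x' y y') N
  simp only [qq_self, abs_mul_abs_self, ← sq] at h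
  refine le_trans ?_ h
  have : ∀ n ∈ Finset.range N, ∫ x, dl (v i) ((P v ^ N) f) x ^ 2 ≤
      ∑ j, ∫ x, dl (v j) ((P v ^ n) f) x ^ 2 := by
    intro n hn
    have hn : n < N := Finset.mem_range.1 hn
    calc ∫ x, dl (v i) ((P v ^ N) f) x ^ 2
        = ∫ x, (P v ^ (N - n)) (dl (v i) ((P v ^ n) f)) x ^ 2 := by
          rw [P_dl, ← Module.End.mul_apply (P v ^ (N - n)), ← pow_add, Nat.sub_add_cancel hn.le]
      _ ≤ ∫ x, dl (v i) ((P v ^ n) f) x ^ 2 := integral_Pn_sq_le v ((hf.Pn v n).dl (v i)) _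
      _ ≤ _ := Finset.single_le_sum (f := fun j => ∫ x, dl (v j) ((P v ^ n) f) x ^ 2)
          (fun j _ => integral_nonneg fun x => sq_nonneg _) (Finset.mem_univ i)
  have := Finset.sum_le_sum this
  simpa using this

/-- `∫ Q(g⁺,k) + ∫ Q(g⁻,k)` -/
def QQ (Q : ℝ → ℝ → ℝ) (g k : E2 → ℝ) : ℝ :=
  (∫ x, Q (max (g x) 0) (k x)) + ∫ x, Q (max (-g x) 0) (k x)

lemma CC.pos {f : E2 → ℝ} (hf : CC f) : CC (fun x => max (f x) 0) :=
  hf.comp (φ := fun t => max t 0) (by fun_prop) (by simp)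
lemma CC.negp {f : E2 → ℝ} (hf : CC f) : CC (fun x => max (-f x) 0) :=
  hf.comp (φ := fun t => max (-t) 0) (by fun_prop) (by simp)

lemma IsBell.zero {p q : ℝ} {Q : ℝ → ℝ → ℝ} {C : ℝ} (hp : 1 < p) (hq : 1 < q)
    (hQ : IsBell p q Q C) : Q 0 0 = 0 := by
  apply le_antisymm _ (hQ.nonneg _ _)
  have := hQ.le 0 0
  rw [abs_zero, Real.zero_rpow (by linarith), Real.zero_rpow (by linarith)] at this
  simpa using this

lemma bell_signed {p q : ℝ} {Q : ℝ → ℝ → ℝ} {C : ℝ} (hp : 1 < p) (hq : 1 < q)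
    (hQ : IsBell p q Q C) (v : Fin 4 → E2) {g k : E2 → ℝ} (hg : CC g) (hk : CC k)
    (hk0 : ∀ x, 0 ≤ k x) (N : ℕ) :
    ∑ n ∈ Finset.range N, ∑ j, ∫ x, |dl (v j) ((P v ^ n) g) x| * |dl (v j) ((P v ^ n) k) x| ≤
      16 * QQ Q g k := by
  have one : ∀ g' : E2 → ℝ, CC g' → (∀ x, 0 ≤ g' x) →
      ∑ n ∈ Finset.range N, ∑ j, ∫ x, |dl (v j) ((P v ^ n) g') x| * |dl (v j) ((P v ^ n) k) x| ≤
      16 * ∫ x, Q (g' x) (k x) := fun g' h1 h2 =>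
    dissipation_sum v hQ.cont (hQ.zero hp hq) hQ.nonneg h1 hk (Ici 0) (convex_Ici 0)
      (fun n x => Pn_nonneg v h2 n x) (fun n x => Pn_nonneg v hk0 n x)
      (fun x x' y y' a b c d => hQ.mid x x' y y' a b c d) N
  have o1 := one _ hg.pos (fun x => le_max_right _ _)
  have o2 := one _ hg.negp (fun x => le_max_right _ _)
  have : 16 * QQ Q g k = 16 * (∫ x, Q (max (g x) 0) (k x))
      + 16 * ∫ x, Q (max (-g x) 0) (k x) := by unfold QQ; ring
  rw [this]
  refine le_trans ?_ (add_le_add o1 o2)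
  rw [← Finset.sum_add_distrib]
  refine Finset.sum_le_sum fun n _ => ?_
  rw [← Finset.sum_add_distrib]
  refine Finset.sum_le_sum fun j _ => ?_
  have hkn := ((hk.Pn v n).dl (v j)).abs
  rw [← integral_add (((hg.pos.Pn v n).dl (v j)).abs.mul hkn).integrable
    (((hg.negp.Pn v n).dl (v j)).abs.mul hkn).integrable]
  refine integral_mono (((hg.Pn v n).dl (v j)).abs.mul hkn).integrable
    ((((hg.pos.Pn v n).dl (v j)).abs.mul hkn).integrable.add
    (((hg.negp.Pn v n).dl (v j)).abs.mul hkn).integrable) fun x => ?_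
  simp only
  rw [← add_mul]
  refine mul_le_mul_of_nonneg_right ?_ (abs_nonneg _)
  have e : g = (fun x => max (g x) 0) - (fun x => max (-g x) 0) := by
    funext y
    simp only [Pi.sub_apply]
    rcases le_total (g y) 0 with h | h
    · rw [max_eq_right h, max_eq_left (by linarith)]; ring
    · rw [max_eq_left h, max_eq_right (by linarith)]; ring
  calc |dl (v j) ((P v ^ n) g) x| = |dl (v j) ((P v ^ n) (fun x => max (g x) 0)) x
        - dl (v j) ((P v ^ n) (fun x => max (-g x) 0)) x| := by
        conv_lhs => rw [e]
        simp only [map_sub, Pi.sub_apply]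
    _ ≤ _ := abs_sub _ _

lemma integral_mul_bound {f k : E2 → ℝ} {M : ℝ} (hf : CC f) (hk : CC k) (hk0 : ∀ x, 0 ≤ k x)
    (h : ∀ x, |f x| ≤ M) : |∫ x, f x * k x| ≤ M * ∫ x, k x := by
  rw [← integral_const_mul]
  refine (abs_integral_le_integral_abs).trans (integral_mono (hf.mul hk).abs.integrable
    (hk.integrable.const_mul M) fun x => ?_)
  simp only
  rw [abs_mul, abs_of_nonneg (hk0 x)]
  exact mul_le_mul_of_nonneg_right (h x) (hk0 x)

lemma term_bound (v : E2) {g k : E2 → ℝ} {c : ℝ} (hc : |c| ≤ 1) (hg : CC g) (hk : CC k) :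
    |∫ x, c * (dl v (dl v g) x * k x)| ≤ ∫ x, |dl v g x| * |dl v k x| := by
  rw [integral_const_mul, integral_dl_dl v hg hk, abs_mul, abs_neg]
  have h1 : |∫ x, dl v g x * dl v k x| ≤ ∫ x, |dl v g x| * |dl v k x| := by
    refine (abs_integral_le_integral_abs).trans (le_of_eq ?_)
    simp only [abs_mul]
  calc _ ≤ 1 * |∫ x, dl v g x * dl v k x| := mul_le_mul_of_nonneg_right hc (abs_nonneg _)
    _ ≤ _ := by rw [one_mul]; exact h1

lemma step_bound (v : Fin 4 → E2) {w D W k : E2 → ℝ} (hw : CC w) (hD : CC D) (hW : CC W)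
    (hk : CC k) (hk0 : ∀ x, 0 ≤ k x) (c d : Fin 4 → ℝ) (hc : ∀ j, |c j| ≤ 1) (hd : ∀ j, |d j| ≤ 1)
    (ρ : ℝ) (hr : ∀ x, |(w - P v (P v w) + (3/16 : ℝ) • ∑ j, (c j • dl (v j) (dl (v j) D)
      + d j • dl (v j) (dl (v j) W))) x| ≤ ρ) (n : ℕ) :
    |(∫ x, (P v ^ n) w x * (P v ^ n) k x) - ∫ x, (P v ^ (n+1)) w x * (P v ^ (n+1)) k x| ≤
      (3/16) * (∑ j, ∫ x, |dl (v j) ((P v ^ n) D) x| * |dl (v j) ((P v ^ n) k) x|)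
      + (3/16) * (∑ j, ∫ x, |dl (v j) ((P v ^ n) W) x| * |dl (v j) ((P v ^ n) k) x|)
      + ρ * ∫ x, k x := by
  set r := w - P v (P v w) + (3/16 : ℝ) • ∑ j, (c j • dl (v j) (dl (v j) D)
      + d j • dl (v j) (dl (v j) W)) with hrdef
  have hwn := hw.Pn v n
  have hkn := hk.Pn v n
  have hDn := hD.Pn v n
  have hWn := hW.Pn v n
  have hsum : CC (∑ j, (c j • dl (v j) (dl (v j) D) + d j • dl (v j) (dl (v j) W))) := by
    rw [Fin.sum_univ_four]
    have : ∀ j, CC (c j • dl (v j) (dl (v j) D) + d j • dl (v j) (dl (v j) W)) := fun j =>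
      (((hD.dl _).dl _).smul _).add (((hW.dl _).dl _).smul _)
    exact (((this 0).add (this 1)).add (this 2)).add (this 3)
  have hrc : CC r := (hw.sub ((hw.P v).P v)).add (hsum.smul _)
  have e1 : ∫ x, (P v ^ (n+1)) w x * (P v ^ (n+1)) k x
      = ∫ x, P v (P v ((P v ^ n) w)) x * (P v ^ n) k x := by
    rw [pow_succ']
    simp only [Module.End.mul_apply]
    exact (integral_P_mul v (hwn.P v) hkn).symm
  have e2 : (P v ^ n) w - P v (P v ((P v ^ n) w)) = (P v ^ n) r
      - (3/16 : ℝ) • ∑ j, (c j • dl (v j) (dl (v j) ((P v ^ n) D))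
      + d j • dl (v j) (dl (v j) ((P v ^ n) W))) := by
    have h1 : ∀ g, (P v ^ n) (P v g) = P v ((P v ^ n) g) := fun g => by
      rw [← Module.End.mul_apply, ← Module.End.mul_apply, ← pow_succ, pow_succ']
    rw [hrdef]
    simp only [map_add, map_sub, map_smul, map_sum, h1, P_dl]
    abel
  have e3 : ∀ x, (P v ^ n) w x * (P v ^ n) k x - P v (P v ((P v ^ n) w)) x * (P v ^ n) k x
      = (P v ^ n) r x * (P v ^ n) k x
       - ((3/16 : ℝ) * (∑ j, c j * (dl (v j) (dl (v j) ((P v ^ n) D)) x * (P v ^ n) k x))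
         + (3/16 : ℝ) * (∑ j, d j * (dl (v j) (dl (v j) ((P v ^ n) W)) x * (P v ^ n) k x))) := by
    intro x
    have := congrFun e2 x
    simp only [Pi.sub_apply, Pi.smul_apply, Finset.sum_apply, Pi.add_apply, smul_eq_mul,
      Finset.sum_add_distrib] at this
    rw [← sub_mul, this]
    simp only [← mul_assoc, ← Finset.sum_mul]
    ring
  have iD : ∀ j ∈ Finset.univ, Integrable (fun x => c j * (dl (v j) (dl (v j) ((P v ^ n) D)) x
      * (P v ^ n) k x)) volume := fun j _ =>
    ((((hDn.dl (v j)).dl (v j)).mul hkn).integrable.const_mul (c j))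
  have iW : ∀ j ∈ Finset.univ, Integrable (fun x => d j * (dl (v j) (dl (v j) ((P v ^ n) W)) x
      * (P v ^ n) k x)) volume := fun j _ =>
    ((((hWn.dl (v j)).dl (v j)).mul hkn).integrable.const_mul (d j))
  rw [e1, ← integral_sub (hwn.mul hkn).integrable (((hwn.P v).P v).mul hkn).integrable]
  simp only [e3]
  have iAB : Integrable (fun x => (3/16 : ℝ) * (∑ j, c j * (dl (v j) (dl (v j) ((P v ^ n) D)) x
      * (P v ^ n) k x)) + (3/16 : ℝ) * (∑ j, d j * (dl (v j) (dl (v j) ((P v ^ n) W)) x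
      * (P v ^ n) k x))) volume :=
    ((integrable_finsetSum _ iD).const_mul _).add ((integrable_finsetSum _ iW).const_mul _)
  rw [integral_sub ((hrc.Pn v n).mul hkn).integrable iAB,
    integral_add ((integrable_finsetSum _ iD).const_mul _)
      ((integrable_finsetSum _ iW).const_mul _), integral_const_mul, integral_const_mul,
    integral_finsetSum _ iD, integral_finsetSum _ iW]
  have b1 : |∫ x, (P v ^ n) r x * (P v ^ n) k x| ≤ ρ * ∫ x, k x := by
    rw [← integral_Pn v hk n]
    exact integral_mul_bound (hrc.Pn v n) hkn (Pn_nonneg v hk0 n) (Pn_bound v hr n)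
  have b2 : |∑ j, ∫ x, c j * (dl (v j) (dl (v j) ((P v ^ n) D)) x * (P v ^ n) k x)| ≤
      ∑ j, ∫ x, |dl (v j) ((P v ^ n) D) x| * |dl (v j) ((P v ^ n) k) x| :=
    (Finset.abs_sum_le_sum_abs _ _).trans
      (Finset.sum_le_sum fun j _ => term_bound (v j) (hc j) hDn hkn)
  have b3 : |∑ j, ∫ x, d j * (dl (v j) (dl (v j) ((P v ^ n) W)) x * (P v ^ n) k x)| ≤
      ∑ j, ∫ x, |dl (v j) ((P v ^ n) W) x| * |dl (v j) ((P v ^ n) k) x| :=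
    (Finset.abs_sum_le_sum_abs _ _).trans
      (Finset.sum_le_sum fun j _ => term_bound (v j) (hd j) hWn hkn)
  rw [abs_le] at b1 b2 b3 ⊢
  constructor <;> linarith [b1.1, b1.2, b2.1, b2.2, b3.1, b3.2]

lemma core_discrete {p q : ℝ} {Q : ℝ → ℝ → ℝ} {C : ℝ} (hp : 1 < p) (hq : 1 < q)
    (hQ : IsBell p q Q C) (v : Fin 4 → E2) {w D W k f : E2 → ℝ} (hw : CC w) (hD : CC D) (hW : CC W)
    (hk : CC k) (hk0 : ∀ x, 0 ≤ k x) (hf : CC f)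
    (c d : Fin 4 → ℝ) (hc : ∀ j, |c j| ≤ 1) (hd : ∀ j, |d j| ≤ 1)
    (ρ : ℝ) (hr : ∀ x, |(w - P v (P v w) + (3/16 : ℝ) • ∑ j, (c j • dl (v j) (dl (v j) D)
      + d j • dl (v j) (dl (v j) W))) x| ≤ ρ)
    (i : Fin 4) (h : ℝ) (hh : 0 < h) (σ : ℝ)
    (hs : ∀ x, |(w - (1 / (2 * h)) • dl (v i) f) x| ≤ σ) (N M : ℕ) (hM : 0 < M) (hN : N = M ^ 2) :
    |∫ x, w x * k x| ≤ 3 * (QQ Q D k + QQ Q W k) + N * ρ * (∫ x, k x) + σ * (∫ x, k x)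
      + 1 / (h * M) * (16 * (∫ x, f x ^ 2) + ∫ x, k x ^ 2) := by
  have tele : |(∫ x, w x * k x) - ∫ x, (P v ^ N) w x * (P v ^ N) k x| ≤
      3 * (QQ Q D k + QQ Q W k) + N * ρ * (∫ x, k x) := by
    have e := Finset.sum_range_sub' (fun n => ∫ x, (P v ^ n) w x * (P v ^ n) k x) N
    simp only [pow_zero, Module.End.one_apply] at e
    rw [← e]
    refine (Finset.abs_sum_le_sum_abs _ _).trans ((Finset.sum_le_sum fun n _ =>
      step_bound v hw hD hW hk hk0 c d hc hd ρ hr n).trans ?_)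
    rw [Finset.sum_add_distrib, Finset.sum_add_distrib, ← Finset.mul_sum, ← Finset.mul_sum]
    have s1 := bell_signed hp hq hQ v hD hk hk0 N
    have s2 := bell_signed hp hq hQ v hW hk hk0 N
    simp only [Finset.sum_const, Finset.card_range, nsmul_eq_mul]
    linarith
  have hwN := hw.Pn v N
  have hkN := hk.Pn v N
  have hfN := hf.Pn v N
  have last : |∫ x, (P v ^ N) w x * (P v ^ N) k x| ≤ σ * (∫ x, k x)
      + 1 / (h * M) * (16 * (∫ x, f x ^ 2) + ∫ x, k x ^ 2) := by
    have hec : CC (w - (1 / (2 * h)) • dl (v i) f) := hw.sub ((hf.dl _).smul _)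
    have e : ∀ x, (P v ^ N) w x * (P v ^ N) k x
        = (P v ^ N) (w - (1 / (2 * h)) • dl (v i) f) x * (P v ^ N) k x
          + (1 / (2 * h)) * (dl (v i) ((P v ^ N) f) x * (P v ^ N) k x) := by
      intro x
      simp only [map_sub, map_smul, P_dl, Pi.sub_apply, Pi.smul_apply, smul_eq_mul]
      ring
    simp only [e]
    rw [integral_add ((hec.Pn v N).mul hkN).integrable
      (((hfN.dl (v i)).mul hkN).integrable.const_mul _), integral_const_mul]
    have b1 : |∫ x, (P v ^ N) (w - (1 / (2 * h)) • dl (v i) f) x * (P v ^ N) k x|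
        ≤ σ * ∫ x, k x := by
      rw [← integral_Pn v hk N]
      exact integral_mul_bound (hec.Pn v N) hkN (Pn_nonneg v hk0 N) (Pn_bound v hs N)
    have hM0 : (0:ℝ) < M := by exact_mod_cast hM
    have b2 : |∫ x, dl (v i) ((P v ^ N) f) x * (P v ^ N) k x| ≤
        1 / M * (16 * (∫ x, f x ^ 2) + ∫ x, k x ^ 2) := by
      have d1 := energy_decay v hf i N
      have d2 := integral_Pn_sq_le v hk N
      have i1 := ((hfN.dl (v i)).sq).integrable
      have i2 := hkN.sq.integrable
      have : |∫ x, dl (v i) ((P v ^ N) f) x * (P v ^ N) k x| ≤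
          ∫ x, (M * dl (v i) ((P v ^ N) f) x ^ 2 + 1 / M * (P v ^ N) k x ^ 2) := by
        refine abs_integral_le_integral_abs.trans (integral_mono
          ((hfN.dl (v i)).mul hkN).abs.integrable ((i1.const_mul _).add (i2.const_mul _)) ?_)
        intro x
        simp only
        generalize dl (v i) ((P v ^ N) f) x = a
        generalize (P v ^ N) k x = b
        have e1 : (M:ℝ) * a ^ 2 + 1 / M * b ^ 2 = (1 / M) * ((M * a) ^ 2 + b ^ 2) := by
          field_simp
        have e2 : a * b = (1 / M) * ((M * a) * b) := by field_simp
        rw [e1, e2, abs_mul, abs_of_pos (show (0:ℝ) < 1 / M by positivity)]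
        refine mul_le_mul_of_nonneg_left ?_ (by positivity)
        generalize (M:ℝ) * a = m
        rw [abs_le]
        constructor <;> nlinarith [sq_nonneg (m - b), sq_nonneg (m + b), sq_nonneg m, sq_nonneg b]
      rw [integral_add (i1.const_mul _) (i2.const_mul _), integral_const_mul,
        integral_const_mul] at this
      have e1 : (M:ℝ) * ∫ x, dl (v i) ((P v ^ N) f) x ^ 2
          = 1 / M * (N * ∫ x, dl (v i) ((P v ^ N) f) x ^ 2) := by
        rw [hN]; push_cast; field_simp
      rw [e1, ← mul_add] at this
      refine this.trans (mul_le_mul_of_nonneg_left (by linarith) (by positivity))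
    have b3 : |(1 / (2 * h)) * ∫ x, dl (v i) ((P v ^ N) f) x * (P v ^ N) k x| ≤
        1 / (h * M) * (16 * (∫ x, f x ^ 2) + ∫ x, k x ^ 2) := by
      rw [abs_mul, abs_of_pos (show (0:ℝ) < 1 / (2 * h) by positivity)]
      have hnn : 0 ≤ 1 / (M:ℝ) * (16 * (∫ x, f x ^ 2) + ∫ x, k x ^ 2) := (abs_nonneg _).trans b2
      calc _ ≤ (1 / h) * (1 / M * (16 * (∫ x, f x ^ 2) + ∫ x, k x ^ 2)) := by
            refine mul_le_mul ?_ b2 (abs_nonneg _) (by positivity)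
            exact one_div_le_one_div_of_le hh (by linarith)
        _ = _ := by rw [← mul_assoc, one_div_mul_one_div]
    exact (abs_add_le _ _).trans (add_le_add b1 b3)
  have := abs_add_le ((∫ x, w x * k x) - ∫ x, (P v ^ N) w x * (P v ^ N) k x)
    (∫ x, (P v ^ N) w x * (P v ^ N) k x)
  rw [sub_add_cancel] at this
  linarith


def SC (f : E2 → ℝ) : Prop := ContDiff ℝ (⊤ : ℕ∞) f ∧ HasCompactSupport f

lemma SC.cc {f : E2 → ℝ} (h : SC f) : CC f := ⟨h.1.continuous, h.2⟩

def dd (v : E2) (f : E2 → ℝ) : E2 → ℝ := fun x => fderiv ℝ f x v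

lemma SC.dd {f : E2 → ℝ} (h : SC f) (v : E2) : SC (dd v f) := by
  refine ⟨?_, ?_⟩
  · have h1 : ContDiff ℝ (⊤ : ℕ∞) (fderiv ℝ f) := h.1.fderiv_right (by simp)
    exact h1.clm_apply contDiff_const
  · exact (h.2.fderiv ℝ).comp_left (g := fun L : E2 →L[ℝ] ℝ => L v) (by simp)

lemma SC.bdd {f : E2 → ℝ} (h : SC f) : ∃ C, 0 ≤ C ∧ ∀ x, |f x| ≤ C := by
  obtain ⟨C, hC⟩ := h.2.exists_bound_of_continuous h.1.continuous
  exact ⟨C, (norm_nonneg _).trans (hC 0), hC⟩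

lemma SC.hasDeriv {f : E2 → ℝ} (h : SC f) (v x : E2) (t : ℝ) :
    HasDerivAt (fun s : ℝ => f (x + s • v)) (_root_.dd v f (x + t • v)) t := by
  have h1 : HasFDerivAt f (fderiv ℝ f (x + t • v)) (x + t • v) :=
    (h.1.differentiable (by simp)).differentiableAt.hasFDerivAt
  have h2 : HasDerivAt (fun s : ℝ => x + s • v) v t := by
    simpa using ((hasDerivAt_id t).smul_const v).const_add x
  exact h1.comp_hasDerivAt t h2

lemma growth {G G' : ℝ → ℝ} (hG : ∀ s, HasDerivAt G (G' s) s) {K : ℝ} {n : ℕ}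
    (hK : ∀ s, |G' s| ≤ K * |s| ^ n) (t : ℝ) : |G t - G 0| ≤ K * |t| ^ (n + 1) := by
  have hK0 : 0 ≤ K := by
    have := (abs_nonneg _).trans (hK 1)
    simpa using this
  have := Convex.norm_image_sub_le_of_norm_hasDerivWithin_le (f := G) (f' := G')
    (s := Set.uIcc 0 t) (C := K * |t| ^ n) (x := 0) (y := t)
    (fun s _ => (hG s).hasDerivWithinAt) (fun s hs => by
      refine (hK s).trans ?_
      have : |s| ≤ |t| := by
        have := Set.abs_sub_left_of_mem_uIcc hs
        simpa using this
      gcongr) (convex_uIcc 0 t) Set.left_mem_uIcc Set.right_mem_uIcc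
  simpa [pow_succ, mul_assoc] using this

lemma SC.taylor1 {f : E2 → ℝ} (h : SC f) (v : E2) :
    ∃ C, 0 ≤ C ∧ ∀ x (t : ℝ), |f (x + t • v) - f x| ≤ C * |t| := by
  obtain ⟨C, hC0, hC⟩ := (h.dd v).bdd
  refine ⟨C, hC0, fun x t => ?_⟩
  have := growth (fun s => h.hasDeriv v x s) (K := C) (n := 0) (fun s => by simpa using hC _) t
  simpa using this

lemma SC.taylor2 {f : E2 → ℝ} (h : SC f) (v : E2) :
    ∃ C, 0 ≤ C ∧ ∀ x (t : ℝ), |f (x + t • v) - f x - t * _root_.dd v f x| ≤ C * |t| ^ 2 := by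
  obtain ⟨C, hC0, hC⟩ := (h.dd v).taylor1 v
  refine ⟨C, hC0, fun x t => ?_⟩
  have := growth (G := fun s => f (x + s • v) - s * _root_.dd v f x)
    (G' := fun s => _root_.dd v f (x + s • v) - 1 * _root_.dd v f x)
    (fun s => (h.hasDeriv v x s).sub ((hasDerivAt_id s).mul_const _)) (K := C) (n := 1)
    (fun s => by simpa using hC x s) t
  simp only [zero_smul, add_zero, zero_mul, sub_zero] at this
  convert this using 2
  ring

lemma SC.taylor3 {f : E2 → ℝ} (h : SC f) (v : E2) :
    ∃ C, 0 ≤ C ∧ ∀ x (t : ℝ), |f (x + t • v) - f x - t * _root_.dd v f x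
      - t ^ 2 / 2 * _root_.dd v (_root_.dd v f) x| ≤ C * |t| ^ 3 := by
  obtain ⟨C, hC0, hC⟩ := (h.dd v).taylor2 v
  refine ⟨C, hC0, fun x t => ?_⟩
  have := growth (G := fun s => f (x + s • v) - s * _root_.dd v f x
      - s ^ 2 / 2 * _root_.dd v (_root_.dd v f) x)
    (G' := fun s => _root_.dd v f (x + s • v) - 1 * _root_.dd v f x
      - s * _root_.dd v (_root_.dd v f) x)
    (fun s => ((h.hasDeriv v x s).sub ((hasDerivAt_id s).mul_const _)).sub (by
      have : HasDerivAt (fun s : ℝ => s ^ 2 / 2) s s := by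
        have := (hasDerivAt_pow 2 s).div_const 2
        simpa using this
      exact this.mul_const _)) (K := C) (n := 2)
    (fun s => by simpa using hC x s) t
  simp only [zero_smul, add_zero, zero_mul, sub_zero, ne_eq, OfNat.ofNat_ne_zero,
    not_false_eq_true, zero_pow, zero_div] at this
  convert this using 2
  ring

lemma SC.sym2 {f : E2 → ℝ} (h : SC f) (v : E2) :
    ∃ C, 0 ≤ C ∧ ∀ x (t : ℝ), 0 ≤ t → |f (x + t • v) + f (x - t • v) - 2 * f x
      - t ^ 2 * _root_.dd v (_root_.dd v f) x| ≤ C * t ^ 3 := by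
  obtain ⟨C, hC0, hC⟩ := h.taylor3 v
  refine ⟨2 * C, by positivity, fun x t ht => ?_⟩
  have h1 := abs_le.1 (hC x t)
  have h2 := abs_le.1 (hC x (-t))
  simp only [neg_smul, ← sub_eq_add_neg, abs_neg, abs_of_nonneg ht, neg_sq] at h1 h2
  rw [abs_le]
  constructor <;> linarith [h1.1, h1.2, h2.1, h2.2]

lemma SC.sym1 {f : E2 → ℝ} (h : SC f) (v : E2) :
    ∃ C, 0 ≤ C ∧ ∀ x (t : ℝ), 0 ≤ t → |f (x + t • v) - f (x - t • v)
      - 2 * t * _root_.dd v f x| ≤ C * t ^ 2 := by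
  obtain ⟨C, hC0, hC⟩ := h.taylor2 v
  refine ⟨2 * C, by positivity, fun x t ht => ?_⟩
  have h1 := abs_le.1 (hC x t)
  have h2 := abs_le.1 (hC x (-t))
  simp only [neg_smul, ← sub_eq_add_neg, abs_neg, abs_of_nonneg ht] at h1 h2
  rw [abs_le]
  constructor <;> linarith [h1.1, h1.2, h2.1, h2.2]

lemma SC.dl_err {f : E2 → ℝ} (h : SC f) (v : E2) :
    ∃ C, 0 ≤ C ∧ ∀ (t : ℝ), 0 < t → ∀ x,
      |(_root_.dd v f - (1 / (2 * t)) • _root_.dl (t • v) f) x| ≤ C * t := by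
  obtain ⟨C, hC0, hC⟩ := h.sym1 v
  refine ⟨C, hC0, fun t ht x => ?_⟩
  have h1 := hC x t ht.le
  simp only [Pi.sub_apply, Pi.smul_apply, smul_eq_mul, dl_apply]
  have e : _root_.dd v f x - 1 / (2 * t) * (f (x + t • v) - f (x - t • v))
    = - (1 / (2 * t)) * (f (x + t • v) - f (x - t • v) - 2 * t * _root_.dd v f x) := by
    field_simp; ring
  rw [e, abs_mul, abs_neg, abs_of_pos (by positivity : 0 < 1 / (2 * t))]
  calc _ ≤ 1 / (2 * t) * (C * t ^ 2) := by gcongr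
    _ = C * t / 2 := by field_simp
    _ ≤ C * t := by have : 0 ≤ C * t := by positivity
                    linarith

lemma SC.dl2_err {f : E2 → ℝ} (h : SC f) (v : E2) :
    ∃ C, 0 ≤ C ∧ ∀ (t : ℝ), 0 ≤ t → ∀ x,
      |_root_.dl (t • v) (_root_.dl (t • v) f) x - 4 * t ^ 2 * _root_.dd v (_root_.dd v f) x|
        ≤ C * t ^ 3 := by
  obtain ⟨C, hC0, hC⟩ := h.sym2 v
  refine ⟨8 * C, by positivity, fun t ht x => ?_⟩
  have h1 := hC x (2 * t) (by positivity)
  have e : _root_.dl (t • v) (_root_.dl (t • v) f) x - 4 * t ^ 2 * _root_.dd v (_root_.dd v f) x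
    = f (x + (2 * t) • v) + f (x - (2 * t) • v) - 2 * f x
      - (2 * t) ^ 2 * _root_.dd v (_root_.dd v f) x := by
    simp only [dl_apply]
    have a1 : x + t • v + t • v = x + (2 * t) • v := by rw [two_mul, add_smul]; abel
    have a2 : x - t • v - t • v = x - (2 * t) • v := by rw [two_mul, add_smul]; abel
    have a3 : x + t • v - t • v = x := by abel
    have a4 : x - t • v + t • v = x := by abel
    rw [a1, a2, a3, a4]; ring
  rw [e]
  refine h1.trans (le_of_eq ?_)
  ring

lemma SC.P_err2 {f : E2 → ℝ} (h : SC f) (V : Fin 4 → E2) :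
    ∃ C, 0 ≤ C ∧ ∀ (t : ℝ), 0 ≤ t → ∀ x,
      |_root_.P (fun j => t • V j) f x - f x
        - t ^ 2 / 8 * ∑ j, _root_.dd (V j) (_root_.dd (V j) f) x| ≤ C * t ^ 3 := by
  choose C hC0 hC using fun j => h.sym2 (V j)
  refine ⟨∑ j, C j, Finset.sum_nonneg fun j _ => hC0 j, fun t ht x => ?_⟩
  have h0 := abs_le.1 (hC 0 x t ht)
  have h1 := abs_le.1 (hC 1 x t ht)
  have h2 := abs_le.1 (hC 2 x t ht)
  have h3 := abs_le.1 (hC 3 x t ht)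
  have n0 : 0 ≤ (C 0 + C 1 + C 2 + C 3) * t ^ 3 := by
    have := hC0 0; have := hC0 1; have := hC0 2; have := hC0 3
    positivity
  rw [P_apply]
  simp only [Fin.sum_univ_four]
  rw [abs_le]
  constructor <;> linarith [h0.1, h0.2, h1.1, h1.2, h2.1, h2.2, h3.1, h3.2]

lemma SC.P_err1 {f : E2 → ℝ} (h : SC f) (V : Fin 4 → E2) :
    ∃ C, 0 ≤ C ∧ ∀ (t : ℝ), 0 ≤ t → ∀ x,
      |_root_.P (fun j => t • V j) f x - f x| ≤ C * t := by
  choose C hC0 hC using fun j => h.taylor1 (V j)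
  refine ⟨∑ j, C j, Finset.sum_nonneg fun j _ => hC0 j, fun t ht x => ?_⟩
  have key : ∀ j, |f (x + t • V j) + f (x - t • V j) - 2 * f x| ≤ 2 * (C j * t) := fun j => by
    have h1 := abs_le.1 (hC j x t)
    have h2 := abs_le.1 (hC j x (-t))
    simp only [neg_smul, ← sub_eq_add_neg, abs_neg, abs_of_nonneg ht] at h1 h2
    rw [abs_le]
    constructor <;> linarith [h1.1, h1.2, h2.1, h2.2]
  have h0 := abs_le.1 (key 0)
  have h1 := abs_le.1 (key 1)
  have h2 := abs_le.1 (key 2)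
  have h3 := abs_le.1 (key 3)
  have n0 : 0 ≤ (C 0 + C 1 + C 2 + C 3) * t := by
    have := hC0 0; have := hC0 1; have := hC0 2; have := hC0 3
    positivity
  rw [P_apply]
  simp only [Fin.sum_univ_four]
  rw [abs_le]
  constructor <;> linarith [h0.1, h0.2, h1.1, h1.2, h2.1, h2.2, h3.1, h3.2]

lemma SC.add {f g : E2 → ℝ} (hf : SC f) (hg : SC g) : SC (f + g) :=
  ⟨hf.1.add hg.1, hf.2.add hg.2⟩

lemma SC.neg {f : E2 → ℝ} (hf : SC f) : SC (-f) := ⟨hf.1.neg, hf.2.neg⟩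

lemma SC.sub {f g : E2 → ℝ} (hf : SC f) (hg : SC g) : SC (f - g) := by
  rw [sub_eq_add_neg]; exact hf.add hg.neg

lemma SC.P2_err {f : E2 → ℝ} (h : SC f) (V : Fin 4 → E2) :
    ∃ C, 0 ≤ C ∧ ∀ (t : ℝ), 0 ≤ t → ∀ x,
      |f x - _root_.P (fun j => t • V j) (_root_.P (fun j => t • V j) f) x
        + t ^ 2 / 4 * ∑ j, _root_.dd (V j) (_root_.dd (V j) f) x| ≤ C * t ^ 3 := by
  obtain ⟨C, hC0, hC⟩ := h.P_err2 V
  set L : E2 → ℝ := ∑ j, _root_.dd (V j) (_root_.dd (V j) f) with hL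
  have hLS : SC L := by
    rw [hL, Fin.sum_univ_four]
    have : ∀ j, SC (_root_.dd (V j) (_root_.dd (V j) f)) := fun j => (h.dd _).dd _
    exact (((this 0).add (this 1)).add (this 2)).add (this 3)
  have hLx : ∀ x, ∑ j, _root_.dd (V j) (_root_.dd (V j) f) x = L x := fun x => by
    rw [hL, Finset.sum_apply]
  obtain ⟨C', hC'0, hC'⟩ := hLS.P_err1 V
  simp only [hLx] at hC ⊢
  refine ⟨2 * C + C', by positivity, fun t ht x => ?_⟩
  set R := _root_.P (fun j => t • V j) with hR
  set e : E2 → ℝ := R f - f - (t ^ 2 / 8) • L with he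
  have hex : ∀ y, |e y| ≤ C * t ^ 3 := fun y => hC t ht y
  have hPe := P_bound (fun j => t • V j) hex x
  rw [← hR] at hPe
  have e1 : R f = f + (t ^ 2 / 8) • L + e := by rw [he]; abel
  have e2 : R (R f) x = R f x + (t ^ 2 / 8) * R L x + R e x := by
    conv_lhs => rw [e1]
    simp
  have e3 : R f x = f x + (t ^ 2 / 8) * L x + e x := congrFun e1 x
  have e4 : f x - R (R f) x + t ^ 2 / 4 * L x
      = -(t ^ 2 / 8 * (R L x - L x)) + -(R e x) + -(e x) := by rw [e2, e3]; ring
  rw [e4]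
  refine (abs_add_three _ _ _).trans ?_
  rw [abs_neg, abs_neg, abs_neg, abs_mul, abs_of_nonneg (by positivity : 0 ≤ t ^ 2 / 8)]
  have := hC' t ht x
  have h5 : t ^ 2 / 8 * |R L x - L x| ≤ t ^ 2 / 8 * (C' * t) := by gcongr
  have h6 : t ^ 2 / 8 * (C' * t) = C' * t ^ 3 / 8 := by ring
  have h7 : 0 ≤ C' * t ^ 3 := by positivity
  have := hex x
  linarith

lemma consistency {w D W : E2 → ℝ} (hw : SC w) (hD : SC D) (hW : SC W) (V : Fin 4 → E2)
    (c d : Fin 4 → ℝ)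
    (hc : ∀ j, |c j| ≤ 1) (hd : ∀ j, |d j| ≤ 1)
    (heq : ∀ x, ∑ j, dd (V j) (dd (V j) w) x
      = 3 * ∑ j, (c j * dd (V j) (dd (V j) D) x + d j * dd (V j) (dd (V j) W) x)) :
    ∃ C, 0 ≤ C ∧ ∀ t : ℝ, 0 ≤ t → ∀ x,
      |(w - P (fun j => t • V j) (P (fun j => t • V j) w) + (3/16 : ℝ) •
        ∑ j, (c j • dl (t • V j) (dl (t • V j) D) + d j • dl (t • V j) (dl (t • V j) W))) x|
        ≤ C * t ^ 3 := by
  obtain ⟨C, hC0, hC⟩ := hw.P2_err V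
  choose A hA0 hA using fun j => hD.dl2_err (V j)
  choose B hB0 hB using fun j => hW.dl2_err (V j)
  refine ⟨C + ∑ j, (A j + B j), add_nonneg hC0 (Finset.sum_nonneg fun j _ =>
    add_nonneg (hA0 j) (hB0 j)), fun t ht x => ?_⟩
  have h1 := hC t ht x
  rw [heq] at h1
  have h2 : |∑ j, (c j * (dl (t • V j) (dl (t • V j) D) x - 4 * t ^ 2 * dd (V j) (dd (V j) D) x)
      + d j * (dl (t • V j) (dl (t • V j) W) x - 4 * t ^ 2 * dd (V j) (dd (V j) W) x))|
      ≤ ∑ j, (A j + B j) * t ^ 3 := by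
    refine (Finset.abs_sum_le_sum_abs _ _).trans (Finset.sum_le_sum fun j _ => ?_)
    refine (abs_add_le _ _).trans ?_
    rw [abs_mul, abs_mul, add_mul]
    have a1 := hA j t ht x
    have a2 := hB j t ht x
    refine add_le_add ?_ ?_
    · calc _ ≤ 1 * (A j * t ^ 3) := by
            refine mul_le_mul (hc j) a1 (abs_nonneg _) zero_le_one
        _ = _ := one_mul _
    · calc _ ≤ 1 * (B j * t ^ 3) := by
            refine mul_le_mul (hd j) a2 (abs_nonneg _) zero_le_one
        _ = _ := one_mul _
  rw [← Finset.sum_mul] at h2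
  have e : (w - P (fun j => t • V j) (P (fun j => t • V j) w) + (3/16 : ℝ) •
        ∑ j, (c j • dl (t • V j) (dl (t • V j) D) + d j • dl (t • V j) (dl (t • V j) W))) x
      = (w x - P (fun j => t • V j) (P (fun j => t • V j) w) x + t ^ 2 / 4 *
        (3 * ∑ j, (c j * dd (V j) (dd (V j) D) x + d j * dd (V j) (dd (V j) W) x)))
       + 3/16 * ∑ j, (c j * (dl (t • V j) (dl (t • V j) D) x - 4 * t ^ 2 * dd (V j) (dd (V j) D) x)
      + d j * (dl (t • V j) (dl (t • V j) W) x - 4 * t ^ 2 * dd (V j) (dd (V j) W) x)) := by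
    simp only [Pi.add_apply, Pi.sub_apply, Pi.smul_apply, Finset.sum_apply, smul_eq_mul,
      Fin.sum_univ_four]
    ring
  rw [e]
  refine (abs_add_le _ _).trans ?_
  rw [abs_mul, abs_of_pos (by norm_num : (0:ℝ) < 3/16)]
  have := abs_nonneg (∑ j, (c j * (dl (t • V j) (dl (t • V j) D) x - 4 * t ^ 2 * dd (V j) (dd (V j) D) x)
      + d j * (dl (t • V j) (dl (t • V j) W) x - 4 * t ^ 2 * dd (V j) (dd (V j) W) x)))
  rw [add_mul]
  linarith

lemma limit_bound {p q : ℝ} {Q : ℝ → ℝ → ℝ} {C : ℝ} (hp : 1 < p) (hq : 1 < q)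
    (hQ : IsBell p q Q C) {f D W k : E2 → ℝ} (hf : SC f) (hD : SC D) (hW : SC W)
    (hk : CC k) (hk0 : ∀ x, 0 ≤ k x) (V : Fin 4 → E2) (i : Fin 4)
    (c d : Fin 4 → ℝ) (hc : ∀ j, |c j| ≤ 1) (hd : ∀ j, |d j| ≤ 1)
    (heq : ∀ x, ∑ j, dd (V j) (dd (V j) (dd (V i) f)) x
      = 3 * ∑ j, (c j * dd (V j) (dd (V j) D) x + d j * dd (V j) (dd (V j) W) x)) :
    |∫ x, dd (V i) f x * k x| ≤ 3 * (QQ Q D k + QQ Q W k) := by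
  obtain ⟨A, hA0, hA⟩ := consistency (hf.dd (V i)) hD hW V c d hc hd heq
  obtain ⟨B, hB0, hB⟩ := hf.dl_err (V i)
  have hK : 0 ≤ ∫ x, k x := integral_nonneg hk0
  set K := ∫ x, k x with hKdef
  obtain ⟨Z, hZ⟩ : ∃ Z, Z = 16 * (∫ x, f x ^ 2) + ∫ x, k x ^ 2 := ⟨_, rfl⟩
  have key : ∀ m : ℕ, 0 < m → |∫ x, dd (V i) f x * k x| ≤ 3 * (QQ Q D k + QQ Q W k)
      + (A * K + B * K + Z) / m := by
    intro m hm
    have hm0 : (0:ℝ) < m := by exact_mod_cast hm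
    have hm1 : (1:ℝ) ≤ m := by exact_mod_cast hm
    have h0 : (0:ℝ) < 1 / (m:ℝ) ^ 5 := by positivity
    have := core_discrete hp hq hQ (fun j => (1 / (m:ℝ) ^ 5) • V j) (hf.dd (V i)).cc hD.cc hW.cc
      hk hk0 hf.cc c d hc hd _ (hA _ h0.le) i _ h0 _ (hB _ h0) (m ^ 12) (m ^ 6) (by positivity)
      (by ring)
    rw [← hKdef, ← hZ] at this
    refine this.trans ?_
    push_cast
    have e1 : (m:ℝ) ^ 12 * (A * (1 / (m:ℝ) ^ 5) ^ 3) * K = A * K / m ^ 3 := by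
      field_simp
    have e2 : B * (1 / (m:ℝ) ^ 5) * K = B * K / m ^ 5 := by field_simp
    have e3 : 1 / (1 / (m:ℝ) ^ 5 * (m:ℝ) ^ 6) * Z = Z / m := by field_simp
    rw [e1, e2, e3, add_div, add_div]
    have l1 : A * K / (m:ℝ) ^ 3 ≤ A * K / m :=
      div_le_div_of_nonneg_left (by positivity) hm0 (le_self_pow₀ hm1 (by norm_num))
    have l2 : B * K / (m:ℝ) ^ 5 ≤ B * K / m :=
      div_le_div_of_nonneg_left (by positivity) hm0 (le_self_pow₀ hm1 (by norm_num))
    linarith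
  have lim : Filter.Tendsto (fun m : ℕ => 3 * (QQ Q D k + QQ Q W k) + (A * K + B * K + Z) / (m:ℝ))
      Filter.atTop (nhds (3 * (QQ Q D k + QQ Q W k) + 0)) :=
    (tendsto_const_div_atTop_nhds_zero_nat _).const_add _
  rw [add_zero] at lim
  refine ge_of_tendsto lim ?_
  filter_upwards [Filter.eventually_gt_atTop 0] with m hm using key m hm

lemma CC.absrpow {g : E2 → ℝ} (hg : CC g) {p : ℝ} (hp : 0 < p) : CC (fun x => |g x| ^ p) :=
  hg.abs.comp (φ := fun y => y ^ p) (continuous_id.rpow_const fun _ => Or.inr hp.le)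
    (Real.zero_rpow hp.ne')

lemma QQ_le {p q : ℝ} {Q : ℝ → ℝ → ℝ} {C : ℝ} (hp : 1 < p) (hq : 1 < q) (hC : 0 < C)
    (hQ : IsBell p q Q C) {g k : E2 → ℝ} (hg : CC g) (hk : CC k) :
    QQ Q g k ≤ 2 * C * ((∫ x, |g x| ^ p) + ∫ x, |k x| ^ q) := by
  have ig := (hg.absrpow (by linarith : 0 < p)).integrable
  have ik := (hk.absrpow (by linarith : 0 < q)).integrable
  have key : ∀ s : E2 → ℝ, (∀ x, |s x| ≤ |g x|) → 
      ∫ x, Q (s x) (k x) ≤ C * ((∫ x, |g x| ^ p) + ∫ x, |k x| ^ q) := by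
    intro s hs
    rw [← integral_add ig ik, ← integral_const_mul]
    refine integral_mono_of_nonneg (Filter.Eventually.of_forall fun x => hQ.nonneg _ _)
      ((ig.add ik).const_mul C) (Filter.Eventually.of_forall fun x => ?_)
    refine (hQ.le _ _).trans ?_
    have := Real.rpow_le_rpow (abs_nonneg _) (hs x) (by linarith : 0 ≤ p)
    simp only [Pi.add_apply]
    gcongr
  have k1 := key (fun x => max (g x) 0) (fun x => by
    rcases le_total (g x) 0 with h | h
    · simp [max_eq_right h]
    · simp [max_eq_left h])
  have k2 := key (fun x => max (-g x) 0) (fun x => by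
    rcases le_total (g x) 0 with h | h
    · simp [max_eq_left (neg_nonneg.2 h)]
    · simp [max_eq_right (neg_nonpos.2 h)])
  unfold QQ
  linarith

lemma pos_bound (p : ℝ) (hp : 1 < p) : ∃ K : ℝ, 0 < K ∧ ∀ (f D W : E2 → ℝ), SC f → SC D → SC W →
    ∀ (V : Fin 4 → E2) (i : Fin 4) (c d : Fin 4 → ℝ), (∀ j, |c j| ≤ 1) → (∀ j, |d j| ≤ 1) →
    (∀ x, ∑ j, dd (V j) (dd (V j) (dd (V i) f)) x
      = 3 * ∑ j, (c j * dd (V j) (dd (V j) D) x + d j * dd (V j) (dd (V j) W) x)) →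
    ∫ x, (max (dd (V i) f x) 0) ^ p ≤ K * ((∫ x, |D x| ^ p) + ∫ x, |W x| ^ p) := by
  have hp1 : 0 < p - 1 := by linarith
  obtain ⟨q, hqdef⟩ : ∃ q, q = p / (p - 1) := ⟨_, rfl⟩
  have hq : 1 < q := by rw [hqdef, lt_div_iff₀ hp1]; linarith
  have hpq : 1 / p + 1 / q = 1 := by rw [hqdef]; field_simp; ring
  obtain ⟨Q, C, hC, hQ⟩ := exists_bell p q hp hq hpq
  have hq1 : (p - 1) * (q - 1) = 1 := by rw [hqdef]; field_simp; ring
  have hpq' : (p - 1) * q = p := by rw [hqdef]; field_simp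
  obtain ⟨l, hl⟩ : ∃ l : ℝ, l = (1 / (24 * C)) ^ (p - 1) := ⟨_, rfl⟩
  have hl0 : 0 < l := by rw [hl]; positivity
  have hlq : l ^ q = l / (24 * C) := by
    have : l ^ (q - 1) = 1 / (24 * C) := by
      rw [hl, ← Real.rpow_mul (by positivity), hq1, Real.rpow_one]
    have e : l ^ q = l ^ (q - 1) * l := by
      rw [← Real.rpow_add_one hl0.ne']; ring_nf
    rw [e, this]; ring
  refine ⟨12 * C / l, by positivity, ?_⟩
  intro f D W hf hD hW V i c d hc hd heq
  have hw := (hf.dd (V i)).cc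
  set w := dd (V i) f with hwdef
  set k : E2 → ℝ := fun x => l * (max (w x) 0) ^ (p - 1) with hkdef
  have hk : CC k := hw.comp (φ := fun y => l * (max y 0) ^ (p - 1))
    (continuous_const.mul ((continuous_id.max continuous_const).rpow_const
      fun _ => Or.inr hp1.le)) (by simp [Real.zero_rpow hp1.ne'])
  have hk0 : ∀ x, 0 ≤ k x := fun x => by
    have : 0 ≤ max (w x) 0 := le_max_right _ _
    simp only [hkdef]; positivity
  have h1 := limit_bound hp hq hQ hf hD hW hk hk0 V i c d hc hd heq
  rw [← hwdef] at h1
  have e1 : ∀ x, w x * k x = l * (max (w x) 0) ^ p := fun x => by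
    simp only [hkdef]
    rcases le_or_gt (w x) 0 with h | h
    · rw [max_eq_right h, Real.zero_rpow hp1.ne', Real.zero_rpow (by linarith)]; ring
    · rw [max_eq_left h.le]
      have : w x ^ p = w x ^ (p - 1) * w x := by
        rw [← Real.rpow_add_one h.ne']; ring_nf
      rw [this]; ring
  have e2 : ∀ x, |k x| ^ q = l ^ q * (max (w x) 0) ^ p := fun x => by
    rw [abs_of_nonneg (hk0 x)]
    simp only [hkdef]
    have : 0 ≤ max (w x) 0 := le_max_right _ _
    rw [Real.mul_rpow hl0.le (by positivity), ← Real.rpow_mul this, hpq']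
  have q1 := QQ_le hp hq hC hQ hD.cc hk
  have q2 := QQ_le hp hq hC hQ hW.cc hk
  simp only [e1, e2, integral_const_mul] at h1 q1 q2
  rw [hlq] at q1 q2
  set X := ∫ x, (max (w x) 0) ^ p with hX
  have h2 := (le_abs_self _).trans h1
  have e5 : 2 * C * (l / (24 * C) * X) = l * X / 12 := by field_simp; ring
  rw [mul_add, e5] at q1 q2
  have h3 : l * X / 2 ≤ 6 * C * ((∫ x, |D x| ^ p) + ∫ x, |W x| ^ p) := by linarith
  rw [div_mul_eq_mul_div, le_div_iff₀ hl0]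
  linarith

lemma dd_neg (v : E2) (f : E2 → ℝ) : dd v (-f) = - dd v f := by
  funext x
  simp [dd, fderiv_neg]

lemma abs_bound (p : ℝ) (hp : 1 < p) : ∃ K : ℝ, 0 < K ∧ ∀ (f D W : E2 → ℝ), SC f → SC D → SC W →
    ∀ (V : Fin 4 → E2) (i : Fin 4) (c d : Fin 4 → ℝ), (∀ j, |c j| ≤ 1) → (∀ j, |d j| ≤ 1) →
    (∀ x, ∑ j, dd (V j) (dd (V j) (dd (V i) f)) x
      = 3 * ∑ j, (c j * dd (V j) (dd (V j) D) x + d j * dd (V j) (dd (V j) W) x)) →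
    ∫ x, |dd (V i) f x| ^ p ≤ K * ((∫ x, |D x| ^ p) + ∫ x, |W x| ^ p) := by
  obtain ⟨K, hK, hb⟩ := pos_bound p hp
  have hp0 : 0 < p := by linarith
  refine ⟨2 * K, by positivity, ?_⟩
  intro f D W hf hD hW V i c d hc hd heq
  have h1 := hb f D W hf hD hW V i c d hc hd heq
  have h2 := hb (-f) D W hf.neg hD hW V i (-c) (-d) (by simpa using hc) (by simpa using hd) (by
    intro x
    have := heq x
    simp only [dd_neg, Pi.neg_apply, Finset.sum_neg_distrib, neg_mul, this, Fin.sum_univ_four]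
    rw [Fin.sum_univ_four, Fin.sum_univ_four] at this
    linarith)
  rw [dd_neg] at h2
  have hw := (hf.dd (V i)).cc
  set w := dd (V i) f with hwdef
  have hcont : Continuous (fun y : ℝ => (max y 0) ^ p) :=
    (continuous_id.max continuous_const).rpow_const fun _ => Or.inr hp0.le
  have h0 : (max (0:ℝ) 0) ^ p = 0 := by simp [Real.zero_rpow hp0.ne']
  have c1 := (hw.comp hcont h0).integrable
  have c2 := (hw.neg.comp hcont h0).integrable
  have e : ∀ x, |w x| ^ p = (max (w x) 0) ^ p + (max ((-w) x) 0) ^ p := fun x => by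
    rcases le_total (w x) 0 with h | h
    · simp [max_eq_right h, abs_of_nonpos h, h, Real.zero_rpow hp0.ne']
    · simp [max_eq_left h, abs_of_nonneg h, h, Real.zero_rpow hp0.ne']
  simp only [e]
  rw [integral_add c1 c2]
  linarith

lemma dd_vadd (v w : E2) (f : E2 → ℝ) : dd (v + w) f = dd v f + dd w f := by
  funext x; simp [dd]

lemma dd_vsub (v w : E2) (f : E2 → ℝ) : dd (v - w) f = dd v f - dd w f := by
  funext x; simp [dd]

lemma SC.diffAt {f : E2 → ℝ} (h : SC f) (x : E2) : DifferentiableAt ℝ f x :=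
  (h.1.differentiable (by simp)).differentiableAt

lemma dd_add (v : E2) {f g : E2 → ℝ} (hf : SC f) (hg : SC g) :
    dd v (f + g) = dd v f + dd v g := by
  funext x
  simp [dd, fderiv_add (hf.diffAt x) (hg.diffAt x)]

lemma dd_sub (v : E2) {f g : E2 → ℝ} (hf : SC f) (hg : SC g) :
    dd v (f - g) = dd v f - dd v g := by
  funext x
  simp [dd, fderiv_sub (hf.diffAt x) (hg.diffAt x)]

lemma dd_comm (v w : E2) {f : E2 → ℝ} (hf : SC f) : dd v (dd w f) = dd w (dd v f) := by
  funext x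
  have h1 : ContDiff ℝ (⊤ : ℕ∞) (fderiv ℝ f) := hf.1.fderiv_right (by simp)
  have h2 : DifferentiableAt ℝ (fderiv ℝ f) x := (h1.differentiable (by simp)).differentiableAt
  have e : ∀ v w : E2, dd v (dd w f) x = fderiv ℝ (fderiv ℝ f) x v w := fun v w => by
    unfold dd
    rw [fderiv_clm_apply h2 (differentiableAt_const _)]
    simp
  rw [e, e]
  exact (hf.1.contDiffAt.isSymmSndFDerivAt (by
    simp only [minSmoothness_of_isRCLikeNormedField]
    exact WithTop.coe_le_coe.2 (le_top : (2 : ℕ∞) ≤ ⊤))).eq v w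

lemma dd_plus (v w : E2) {f : E2 → ℝ} (hf : SC f) :
    dd (v + w) (dd (v + w) f) = dd v (dd v f) + (2:ℝ) • dd v (dd w f) + dd w (dd w f) := by
  rw [dd_vadd v w f, dd_vadd, dd_add _ (hf.dd _) (hf.dd _), dd_add _ (hf.dd _) (hf.dd _),
    dd_comm w v hf, two_smul]
  abel

lemma dd_minus (v w : E2) {f : E2 → ℝ} (hf : SC f) :
    dd (v - w) (dd (v - w) f) = dd v (dd v f) - (2:ℝ) • dd v (dd w f) + dd w (dd w f) := by
  rw [dd_vsub v w f, dd_vsub, dd_sub _ (hf.dd _) (hf.dd _), dd_sub _ (hf.dd _) (hf.dd _),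
    dd_comm w v hf, two_smul]
  abel

lemma m0 (a b c d : ℝ) : ![a, b, c, d] 0 = a := rfl
lemma m1 (a b c d : ℝ) : ![a, b, c, d] 1 = b := rfl
lemma m2 (a b c d : ℝ) : ![a, b, c, d] 2 = c := rfl
lemma m3 (a b c d : ℝ) : ![a, b, c, d] 3 = d := rfl

def VV (v w : E2) : Fin 4 → E2 := ![v, w, v + w, v - w]

lemma laplace_eq (v w : E2) {g D W : E2 → ℝ} (hg : SC g) (hD : SC D) (hW : SC W)
    (c d : Fin 4 → ℝ)
    (h : dd v (dd v g) + dd w (dd w g) =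
      (c 0 + c 2 + c 3) • dd v (dd v D) + (c 1 + c 2 + c 3) • dd w (dd w D)
      + (2 * (c 2 - c 3)) • dd v (dd w D)
      + ((d 0 + d 2 + d 3) • dd v (dd v W) + (d 1 + d 2 + d 3) • dd w (dd w W)
      + (2 * (d 2 - d 3)) • dd v (dd w W))) (x : E2) :
    ∑ j, dd (VV v w j) (dd (VV v w j) g) x
      = 3 * ∑ j, (c j * dd (VV v w j) (dd (VV v w j) D) x
        + d j * dd (VV v w j) (dd (VV v w j) W) x) := by
  have hx := congrFun h x
  simp only [Pi.add_apply, Pi.smul_apply, smul_eq_mul] at hx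
  have e0 : VV v w 0 = v := rfl
  have e1 : VV v w 1 = w := rfl
  have e2 : VV v w 2 = v + w := rfl
  have e3 : VV v w 3 = v - w := rfl
  simp only [Fin.sum_univ_four, e0, e1, e2, e3, dd_plus v w hg, dd_plus v w hD, dd_plus v w hW,
    dd_minus v w hg, dd_minus v w hD, dd_minus v w hW, Pi.add_apply, Pi.sub_apply, Pi.smul_apply,
    smul_eq_mul]
  linarith

lemma four_bounds (p : ℝ) (hp : 1 < p) : ∃ K : ℝ, 0 < K ∧ ∀ (a b : E2 → ℝ), SC a → SC b →
    ∀ (v w : E2),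
    (∫ x, |dd v a x| ^ p ≤ K * ((∫ x, |(dd v a + dd w b) x| ^ p) + ∫ x, |(dd v b - dd w a) x| ^ p)) ∧
    (∫ x, |dd w a x| ^ p ≤ K * ((∫ x, |(dd v a + dd w b) x| ^ p) + ∫ x, |(dd v b - dd w a) x| ^ p)) ∧
    (∫ x, |dd v b x| ^ p ≤ K * ((∫ x, |(dd v a + dd w b) x| ^ p) + ∫ x, |(dd v b - dd w a) x| ^ p)) ∧
    (∫ x, |dd w b x| ^ p ≤ K * ((∫ x, |(dd v a + dd w b) x| ^ p)
      + ∫ x, |(dd v b - dd w a) x| ^ p)) := by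
  obtain ⟨K, hK, hb⟩ := abs_bound p hp
  refine ⟨K, hK, fun a b ha hbb v w => ?_⟩
  have hD : SC (dd v a + dd w b) := (ha.dd _).add (hbb.dd _)
  have hW : SC (dd v b - dd w a) := (hbb.dd _).sub (ha.dd _)
  have s2 : ∀ (z y : E2) {g : E2 → ℝ}, SC g → SC (dd z (dd y g)) := fun z y g hg => (hg.dd y).dd z
  have A := dd_comm w v ha
  have B := dd_comm w v hbb
  have A1 := dd_comm w v (ha.dd v)
  have A2 := dd_comm w v (ha.dd w)
  have B1 := dd_comm w v (hbb.dd v)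
  have B2 := dd_comm w v (hbb.dd w)
  have D1 : ∀ z, dd z (dd v a + dd w b) = dd z (dd v a) + dd z (dd w b) := fun z =>
    dd_add z (ha.dd _) (hbb.dd _)
  have D2 : ∀ z y, dd y (dd z (dd v a) + dd z (dd w b))
      = dd y (dd z (dd v a)) + dd y (dd z (dd w b)) := fun z y =>
    dd_add y (s2 _ _ ha) (s2 _ _ hbb)
  have W1 : ∀ z, dd z (dd v b - dd w a) = dd z (dd v b) - dd z (dd w a) := fun z =>
    dd_sub z (hbb.dd _) (ha.dd _)
  have W2 : ∀ z y, dd y (dd z (dd v b) - dd z (dd w a))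
      = dd y (dd z (dd v b)) - dd y (dd z (dd w a)) := fun z y =>
    dd_sub y (s2 _ _ hbb) (s2 _ _ ha)
  refine ⟨?_, ?_, ?_, ?_⟩
  · refine hb a _ _ ha hD hW (VV v w) 0 ![1, 0, 0, 0] ![0, 0, -1/4, 1/4] ?_ ?_
      (laplace_eq v w (ha.dd v) hD hW _ _ ?_)
    · intro j; fin_cases j <;> simp
    · intro j; fin_cases j <;> norm_num [abs_le]
    · simp only [D1, D2, W1, W2]
      funext x
      simp only [m0, m1, m2, m3, A, B, A1, A2, B1, B2, Pi.add_apply, Pi.sub_apply, Pi.smul_apply,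
        smul_eq_mul]
      ring
  · refine hb a _ _ ha hD hW (VV v w) 1 ![0, 0, 1/4, -1/4] ![0, -1, 0, 0] ?_ ?_
      (laplace_eq v w (ha.dd w) hD hW _ _ ?_)
    · intro j; fin_cases j <;> norm_num [abs_le]
    · intro j; fin_cases j <;> simp
    · simp only [D1, D2, W1, W2]
      funext x
      simp only [m0, m1, m2, m3, A, B, A1, A2, B1, B2, Pi.add_apply, Pi.sub_apply, Pi.smul_apply,
        smul_eq_mul]
      ring
  · refine hb b _ _ hbb hD hW (VV v w) 0 ![0, 0, 1/4, -1/4] ![1, 0, 0, 0] ?_ ?_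
      (laplace_eq v w (hbb.dd v) hD hW _ _ ?_)
    · intro j; fin_cases j <;> norm_num [abs_le]
    · intro j; fin_cases j <;> simp
    · simp only [D1, D2, W1, W2]
      funext x
      simp only [m0, m1, m2, m3, A, B, A1, A2, B1, B2, Pi.add_apply, Pi.sub_apply, Pi.smul_apply,
        smul_eq_mul]
      ring
  · refine hb b _ _ hbb hD hW (VV v w) 1 ![0, 1, 0, 0] ![0, 0, 1/4, -1/4] ?_ ?_
      (laplace_eq v w (hbb.dd w) hD hW _ _ ?_)
    · intro j; fin_cases j <;> simp
    · intro j; fin_cases j <;> norm_num [abs_le]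
    · simp only [D1, D2, W1, W2]
      funext x
      simp only [m0, m1, m2, m3, A, B, A1, A2, B1, B2, Pi.add_apply, Pi.sub_apply, Pi.smul_apply,
        smul_eq_mul]
      ring

lemma lpnorm_eq {w : E2 → ℝ} (hw : CC w) {p : ℝ} (hp : 1 < p) :
    lpnorm w (ENNReal.ofReal p) = (∫ x, |w x| ^ p) ^ (1 / p) := by
  have hp0 : 0 < p := by linarith
  have hm : MemLp w (ENNReal.ofReal p) volume := hw.1.memLp_of_hasCompactSupport hw.2
  unfold lpnorm
  rw [hm.eLpNorm_eq_integral_rpow_norm (by simpa using hp0) ENNReal.ofReal_ne_top,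
    ENNReal.toReal_ofReal hp0.le, ENNReal.toReal_ofReal, one_div]
  · rfl
  · exact Real.rpow_nonneg (integral_nonneg fun x => Real.rpow_nonneg (norm_nonneg _) _) _

lemma opnorm_le (L : E2 →L[ℝ] E2) :
    ‖L‖ ≤ |L (EuclideanSpace.single 0 1) 0| + |L (EuclideanSpace.single 0 1) 1|
      + |L (EuclideanSpace.single 1 1) 0| + |L (EuclideanSpace.single 1 1) 1| := by
  have h2 : ∀ y : E2, ‖y‖ ≤ |y 0| + |y 1| := fun y => by
    rw [EuclideanSpace.norm_eq, Fin.sum_univ_two]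
    refine Real.sqrt_le_iff.2 ⟨by positivity, ?_⟩
    simp only [Real.norm_eq_abs]
    nlinarith [abs_nonneg (y 0), abs_nonneg (y 1)]
  have h3 : ∀ (y : E2) (i : Fin 2), |y i| ≤ ‖y‖ := fun y i => PiLp.norm_apply_le y i
  refine ContinuousLinearMap.opNorm_le_bound _ (by positivity) fun y => ?_
  have e : y = y 0 • EuclideanSpace.single 0 1 + y 1 • EuclideanSpace.single 1 1 := by
    ext i; fin_cases i <;> simp
  have e2 : L y = y 0 • L (EuclideanSpace.single 0 1) + y 1 • L (EuclideanSpace.single 1 1) := by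
    conv_lhs => rw [e]
    simp only [map_add, map_smul]
  rw [e2]
  refine (norm_add_le _ _).trans ?_
  rw [norm_smul, norm_smul]
  have a1 := h2 (L (EuclideanSpace.single 0 1))
  have a2 := h2 (L (EuclideanSpace.single 1 1))
  have b1 : ‖y 0‖ ≤ ‖y‖ := h3 y 0
  have b2 : ‖y 1‖ ≤ ‖y‖ := h3 y 1
  calc _ ≤ ‖y‖ * (|L (EuclideanSpace.single 0 1) 0| + |L (EuclideanSpace.single 0 1) 1|)
        + ‖y‖ * (|L (EuclideanSpace.single 1 1) 0| + |L (EuclideanSpace.single 1 1) 1|) := by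
        gcongr
    _ = _ := by ring

lemma lpnorm_four {p : ℝ} (hp : 1 < p) {F : E2 → (E2 →L[ℝ] E2)} {w1 w2 w3 w4 : E2 → ℝ}
    (h1 : CC w1) (h2 : CC w2) (h3 : CC w3) (h4 : CC w4)
    (hF : ∀ x, ‖F x‖ ≤ |w1 x| + |w2 x| + |w3 x| + |w4 x|) :
    lpnorm F (ENNReal.ofReal p) ≤ lpnorm w1 (ENNReal.ofReal p) + lpnorm w2 (ENNReal.ofReal p)
      + lpnorm w3 (ENNReal.ofReal p) + lpnorm w4 (ENNReal.ofReal p) := by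
  set P := ENNReal.ofReal p with hP
  have hP1 : 1 ≤ P := by rw [hP, ENNReal.one_le_ofReal]; exact hp.le
  have fin : ∀ {w : E2 → ℝ}, CC w → eLpNorm w P volume ≠ ⊤ := fun hw =>
    (hw.1.memLp_of_hasCompactSupport hw.2).eLpNorm_ne_top
  have ab : ∀ w : E2 → ℝ, eLpNorm (fun x => |w x|) P volume = eLpNorm w P volume := fun w =>
    eLpNorm_norm w
  have ms : ∀ {w : E2 → ℝ}, CC w → AEStronglyMeasurable (fun x => |w x|) volume := fun hw =>
    hw.abs.1.aestronglyMeasurable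
  have key : eLpNorm F P volume ≤ eLpNorm w1 P volume + eLpNorm w2 P volume
      + eLpNorm w3 P volume + eLpNorm w4 P volume := by
    refine (eLpNorm_mono_real hF).trans ?_
    have s3 := eLpNorm_add_le (((ms h1).add (ms h2)).add (ms h3)) (ms h4) hP1
    have s2 := eLpNorm_add_le ((ms h1).add (ms h2)) (ms h3) hP1
    have s1 := eLpNorm_add_le (ms h1) (ms h2) hP1
    simp only [ab] at s1 s2 s3
    refine s3.trans ?_
    gcongr
    refine s2.trans ?_
    gcongr
  unfold lpnorm
  have f12 := ENNReal.add_ne_top.2 ⟨fin h1, fin h2⟩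
  have f123 := ENNReal.add_ne_top.2 ⟨f12, fin h3⟩
  have f1234 := ENNReal.add_ne_top.2 ⟨f123, fin h4⟩
  have := ENNReal.toReal_mono f1234 key
  rwa [ENNReal.toReal_add f123 (fin h4), ENNReal.toReal_add f12 (fin h3),
    ENNReal.toReal_add (fin h1) (fin h2)] at this

/-- **`L^p` bound of the gradient by divergence and vorticity** (Lemma 2.4(1)): for every
`1 < p < ∞` there is `C = C(p) > 0` such that for all `u ∈ C_c^∞(ℝ²;ℝ²)`,
`‖∇u‖_p ≤ C (‖div u‖_p + ‖ω‖_p)`. -/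
theorem gradient_bound_div_vort (p : ℝ) (hp : 1 < p) :
    ∃ C : ℝ, 0 < C ∧ ∀ u : E2 → E2, ContDiff ℝ (⊤ : ℕ∞) u → HasCompactSupport u →
      lpnorm (fderiv ℝ u) (ENNReal.ofReal p) ≤
        C * (lpnorm (div2 u) (ENNReal.ofReal p) + lpnorm (vort u) (ENNReal.ofReal p)) := by
  obtain ⟨K, hK, hb⟩ := four_bounds p hp
  have hp0 : 0 < p := by linarith
  refine ⟨4 * K ^ (1 / p), by positivity, fun u hu hcu => ?_⟩
  have sc : ∀ i : Fin 2, SC (fun y => u y i) := fun i => by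
    refine ⟨(EuclideanSpace.proj (𝕜 := ℝ) i).contDiff.comp hu, ?_⟩
    exact hcu.comp_left (g := fun y : E2 => y i) (by simp)
  have hder : ∀ (i : Fin 2) (x v : E2), fderiv ℝ u x v i = dd v (fun y => u y i) x := by
    intro i x v
    have h1 : HasFDerivAt u (fderiv ℝ u x) x :=
      (hu.differentiable (by simp)).differentiableAt.hasFDerivAt
    have h2 := (EuclideanSpace.proj (𝕜 := ℝ) i).hasFDerivAt.comp x h1
    have h3 : fderiv ℝ (fun y => u y i) x = (EuclideanSpace.proj (𝕜 := ℝ) i).comp (fderiv ℝ u x) :=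
      h2.fderiv
    unfold dd
    rw [h3]
    rfl
  set a : E2 → ℝ := fun y => u y 0 with ha
  set b : E2 → ℝ := fun y => u y 1 with hbdef
  have sa : SC a := sc 0
  have sb : SC b := sc 1
  set v : E2 := EuclideanSpace.single 0 1 with hv
  set w : E2 := EuclideanSpace.single 1 1 with hw
  have eD : div2 u = dd v a + dd w b := by
    funext x
    simp only [div2, Fin.sum_univ_two]
    rfl
  have eW : vort u = dd v b - dd w a := rfl
  obtain ⟨b1, b2, b3, b4⟩ := hb a b sa sb v w
  have hD : CC (dd v a + dd w b) := ((sa.dd v).add (sb.dd w)).cc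
  have hW : CC (dd v b - dd w a) := ((sb.dd v).sub (sa.dd w)).cc
  have h4 := lpnorm_four hp (F := fderiv ℝ u) (sa.dd v).cc (sb.dd v).cc (sa.dd w).cc (sb.dd w).cc
    (fun x => by
      have := opnorm_le (fderiv ℝ u x)
      simp only [hder] at this
      exact this)
  rw [eD, eW]
  rw [lpnorm_eq (sa.dd v).cc hp, lpnorm_eq (sb.dd v).cc hp, lpnorm_eq (sa.dd w).cc hp,
    lpnorm_eq (sb.dd w).cc hp] at h4
  rw [lpnorm_eq hD hp, lpnorm_eq hW hp]
  have nn : ∀ g : E2 → ℝ, 0 ≤ ∫ x, |g x| ^ p := fun g =>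
    integral_nonneg fun x => Real.rpow_nonneg (abs_nonneg _) _
  have fin : ∀ g : E2 → ℝ, ∫ x, |g x| ^ p ≤ K * ((∫ x, |(dd v a + dd w b) x| ^ p)
      + ∫ x, |(dd v b - dd w a) x| ^ p) → (∫ x, |g x| ^ p) ^ (1 / p) ≤
      K ^ (1 / p) * ((∫ x, |(dd v a + dd w b) x| ^ p) ^ (1 / p)
      + (∫ x, |(dd v b - dd w a) x| ^ p) ^ (1 / p)) := by
    intro g hg
    have hd := nn (dd v a + dd w b)
    have hw' := nn (dd v b - dd w a)
    refine (Real.rpow_le_rpow (nn g) hg (by positivity)).trans ?_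
    rw [Real.mul_rpow hK.le (by positivity)]
    refine mul_le_mul_of_nonneg_left ?_ (by positivity)
    exact Real.rpow_add_le_add_rpow hd hw' (by positivity) (by
      rw [div_le_one hp0]; exact hp.le)
  have f1 := fin _ b1
  have f2 := fin _ b2
  have f3 := fin _ b3
  have f4 := fin _ b4
  linarith
end
end
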